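/- Fix β with β_i - β_j ∉ ℤ for i ≠ j, and for k ∈ ℤ^p let τ^{(k)} ∈ Y_p(gl_2) be the product Π_{i: k_i>0} T_{21}(-β_i-k_i+1)···T_{21}(-β_i) · Π_{i: k_i<0} T_{12}(-β_i-k_i-1)···T_{12}(-β_i). Then the family {τ^{(k)} : k ∈ ℤ^p} is linearly independent over Γ in the right Γ-module Y_p(gl_2), i.e., if Σ_{(k)} τ^{(k)} c_{(k)} = 0 with c_{(k)} ∈ Γ almost all zero, then all c_{(k)} = 0. -/

import Mathlib

open Polynomial

/-- Generator index for the level-`p` Yangian: `(i, j, k)` with `k : Fin p` encoding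
the superscript `k+1`. -/
abbrev YGen (p : ℕ) := Fin 2 × Fin 2 × Fin p

/-- The free-algebra version of the generator `t_{ij}^{(r)}`, with the conventions
`t_{ij}^{(0)} = δ_{ij}` and `t_{ij}^{(r)} = 0` for `r > p`. -/
noncomputable def tF (K : Type) [Field K] (p : ℕ) (i j : Fin 2) (r : ℕ) :
    FreeAlgebra K (YGen p) :=
  if h0 : r = 0 then (if i = j then 1 else 0)
  else if h : r ≤ p then FreeAlgebra.ι K (i, j, (⟨r - 1, by omega⟩ : Fin p)) else 0

/-- The defining relations of the level-`p` Yangian: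
`[t_{ij}^{(r)}, t_{kl}^{(s)}] = Σ_{a=1}^{min(r,s)} (t_{kj}^{(a-1)} t_{il}^{(r+s-a)} -
t_{kj}^{(r+s-a)} t_{il}^{(a-1)})`. -/
inductive YRel (K : Type) [Field K] (p : ℕ) :
    FreeAlgebra K (YGen p) → FreeAlgebra K (YGen p) → Prop
  | rel (i j k l : Fin 2) (r s : ℕ) (hr : 1 ≤ r) (hr' : r ≤ p) (hs : 1 ≤ s) (hs' : s ≤ p) :
      YRel K p (tF K p i j r * tF K p k l s - tF K p k l s * tF K p i j r)
        (∑ a ∈ Finset.Icc 1 (min r s),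
          (tF K p k j (a - 1) * tF K p i l (r + s - a)
            - tF K p k j (r + s - a) * tF K p i l (a - 1)))

/-- The level-`p` Yangian `Y_p(gl_2)`. -/
abbrev Yp (K : Type) [Field K] (p : ℕ) := RingQuot (YRel K p)

/-- The generator `t_{ij}^{(r)}` of `Y_p(gl_2)` (matrix indices `0,1` stand for `1,2`). -/
noncomputable def tY (K : Type) [Field K] (p : ℕ) (i j : Fin 2) (r : ℕ) : Yp K p :=
  RingQuot.mkAlgHom K (YRel K p) (tF K p i j r)

/-- The generating polynomial `T_{ij}(u) = δ_{ij} u^p + Σ_{k=1}^p t_{ij}^{(k)} u^{p-k}`. -/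
noncomputable def TY (K : Type) [Field K] (p : ℕ) (i j : Fin 2) : Polynomial (Yp K p) :=
  (if i = j then X ^ p else 0) + ∑ k ∈ Finset.Icc 1 p, C (tY K p i j k) * X ^ (p - k)

/-- The quantum determinant `D(u) = T_{11}(u) T_{22}(u-1) - T_{21}(u) T_{12}(u-1)`. -/
noncomputable def DY (K : Type) [Field K] (p : ℕ) : Polynomial (Yp K p) :=
  TY K p 0 0 * (TY K p 1 1).comp (X - 1) - TY K p 1 0 * (TY K p 0 1).comp (X - 1)

/-- The coefficient `d_i` of the quantum determinant: `D(u) = u^{2p} + Σ_i d_i u^{2p-i}`. -/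
noncomputable def dY (K : Type) [Field K] (p : ℕ) (i : ℕ) : Yp K p :=
  (DY K p).coeff (2 * p - i)

/-- The commutative subalgebra `Γ` generated by `t_{22}^{(1)},…,t_{22}^{(p)}` and
`d_1,…,d_{2p}`. -/
noncomputable def Gam (K : Type) [Field K] (p : ℕ) : Subalgebra K (Yp K p) :=
  Algebra.adjoin K
    ({x | ∃ k ∈ Finset.Icc 1 p, x = tY K p 1 1 k} ∪
     {x | ∃ i ∈ Finset.Icc 1 (2 * p), x = dY K p i})

open Polynomial

/-- The descending product `T_21(-β_i - n + 1) ⋯ T_21(-β_i - 1) T_21(-β_i)`. -/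
noncomputable def prod21 (K : Type) [Field K] (p : ℕ) (β : Fin p → K) (i : Fin p) :
    ℕ → Yp K p
  | 0 => 1
  | n + 1 => (TY K p 1 0).eval (algebraMap K (Yp K p) (-β i - (n : K))) * prod21 K p β i n

/-- The descending product `T_12(-β_i + n - 1) ⋯ T_12(-β_i + 1) T_12(-β_i)`. -/
noncomputable def prod12 (K : Type) [Field K] (p : ℕ) (β : Fin p → K) (i : Fin p) :
    ℕ → Yp K p
  | 0 => 1
  | n + 1 => (TY K p 0 1).eval (algebraMap K (Yp K p) (-β i + (n : K))) * prod12 K p β i n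

/-- The element `τ^(k)` of `Y_p(gl_2)`:
`τ^(k) = Π_(i : k_i>0) T_21(-β_i-k_i+1)⋯T_21(-β_i) · Π_(i : k_i<0) T_12(-β_i-k_i-1)⋯T_12(-β_i)`. -/
noncomputable def tau (K : Type) [Field K] (p : ℕ) (β : Fin p → K) (k : Fin p → ℤ) :
    Yp K p :=
  ((List.finRange p).map (fun i => prod21 K p β i (k i).toNat)).prod *
    ((List.finRange p).map (fun i => prod12 K p β i (-(k i)).toNat)).prod

section Sequences

variable {R : Type*} [Ring R]

/-- The RTT relation `[x(u), y(v)] (u - v) = z(u) w(v) - z(v) w(u)` in coefficient form. -/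
def RTT (x y z w : ℕ → R) : Prop :=
  ∀ r s, x (r + 1) * y s - y s * x (r + 1) - (x r * y (s + 1) - y (s + 1) * x r)
    = z r * w s - z s * w r

/-- The summed right-hand side of the defining relations of the Yangian. -/
def rttSum (z w : ℕ → R) (r s : ℕ) : R :=
  ∑ a ∈ Finset.Icc 1 (min r s), (z (a - 1) * w (r + s - a) - z (r + s - a) * w (a - 1))

theorem rttSum_zero_left (z w : ℕ → R) (s : ℕ) : rttSum z w 0 s = 0 := by
  simp [rttSum]

theorem rttSum_zero_right (z w : ℕ → R) (r : ℕ) : rttSum z w r 0 = 0 := by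
  simp [rttSum]

theorem rttSum_succ_sub (z w : ℕ → R) (r s : ℕ) :
    rttSum z w (r + 1) s - rttSum z w r (s + 1) = z r * w s - z s * w r := by
  unfold rttSum
  have e : r + 1 + s = r + (s + 1) := by omega
  rw [e]
  rcases lt_trichotomy r s with h | h | h
  · rw [min_eq_left (by omega : r + 1 ≤ s), min_eq_left (by omega : r ≤ s + 1),
      Finset.sum_Icc_succ_top (by omega)]
    simp [show r + (s + 1) - (r + 1) = s by omega]
  · subst h
    simp
  · rw [min_eq_right (by omega : s ≤ r + 1), min_eq_right (by omega : s + 1 ≤ r),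
      Finset.sum_Icc_succ_top (by omega)]
    simp [show r + (s + 1) - (s + 1) = r by omega]

theorem rttSum_eq_zero_of_lt {z w : ℕ → R} {p : ℕ} (hz : ∀ r, p < r → z r = 0)
    (hw : ∀ r, p < r → w r = 0) {r s : ℕ} (h : p < r ∨ p < s) : rttSum z w r s = 0 := by
  refine Finset.sum_eq_zero fun a ha => ?_
  rw [Finset.mem_Icc, le_min_iff] at ha
  rw [hz (r + s - a) (by omega), hw (r + s - a) (by omega)]
  simp

theorem RTT.commutator_eq {x y z w : ℕ → R} (h : RTT x y z w) (hx : ∀ a, x 0 * a = a * x 0)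
    (r s : ℕ) : x r * y s - y s * x r = rttSum z w r s := by
  induction r generalizing s with
  | zero => rw [rttSum_zero_left, hx, sub_self]
  | succ r ih =>
    have h1 := h r s
    rw [ih (s + 1), ← rttSum_succ_sub] at h1
    exact sub_left_injective h1

theorem RTT.of_commutator_eq {x y z w : ℕ → R}
    (h : ∀ r s, x r * y s - y s * x r = rttSum z w r s) : RTT x y z w := fun r s => by
  rw [h, h, rttSum_succ_sub]

theorem RTT.commutator_symm {x y z w : ℕ → R} (h : RTT x y z w) (hx : ∀ a, x 0 * a = a * x 0)
    (hy : ∀ a, y 0 * a = a * y 0) (r s : ℕ) :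
    x r * y s - y s * x r = x s * y r - y r * x s := by
  induction r generalizing s with
  | zero => rw [hx, ← hy]; simp
  | succ r ih =>
    have h1 := h r s
    have h2 := h s r
    have h3 := ih (s + 1)
    linear_combination (norm := noncomm_ring) h1 + h2 + h3

theorem RTT.swap {x y z w z' w' : ℕ → R} (h : RTT x y z w) (h' : RTT z w z' w')
    (hz : ∀ a, z 0 * a = a * z 0) (hw : ∀ a, w 0 * a = a * w 0) : RTT y x w z := fun r s => by
  have h1 := h s r
  have h2 := h'.commutator_symm hz hw r s
  linear_combination (norm := noncomm_ring) h1 - h2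

/-- The polynomial `∑_{r ≤ p} x_r X^{p-r}`. -/
noncomputable def seqPoly (p : ℕ) (x : ℕ → R) : R[X] :=
  ∑ r ∈ Finset.range (p + 1), C (x r) * X ^ (p - r)

theorem seqPoly_coeff (p : ℕ) (x : ℕ → R) (n : ℕ) :
    (seqPoly p x).coeff n = if n ≤ p then x (p - n) else 0 := by
  simp only [seqPoly, finsetSum_coeff, coeff_C_mul, coeff_X_pow]
  split_ifs with h
  · rw [Finset.sum_eq_single (p - n)]
    · simp [show p - (p - n) = n by omega]
    · intro b hb hbn
      rw [Finset.mem_range] at hb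
      rw [if_neg (by omega), mul_zero]
    · intro hn
      exact absurd (Finset.mem_range.2 (by omega)) hn
  · refine Finset.sum_eq_zero fun b hb => ?_
    rw [if_neg (by omega), mul_zero]

theorem seqPoly_eq_zero {p : ℕ} {x : ℕ → R} (h : seqPoly p x = 0) {r : ℕ} (hr : r ≤ p) :
    x r = 0 := by
  have := congrArg (fun q => coeff q (p - r)) h
  simpa [seqPoly_coeff, show p - (p - r) = r by omega] using this

theorem seqPoly_monic (p : ℕ) {x : ℕ → R} (h : x 0 = 1) : (seqPoly p x).Monic := by
  refine monic_of_natDegree_le_of_coeff_eq_one p ?_ (by simp [seqPoly_coeff, h])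
  rw [natDegree_le_iff_coeff_eq_zero]
  intro n hn
  rw [seqPoly_coeff, if_neg (by omega)]

theorem seqPoly_sub (p : ℕ) (x y : ℕ → R) :
    seqPoly p (fun r => x r - y r) = seqPoly p x - seqPoly p y := by
  simp [seqPoly, sub_mul, Finset.sum_sub_distrib]

theorem seqPoly_add (p : ℕ) (x y : ℕ → R) :
    seqPoly p (fun r => x r + y r) = seqPoly p x + seqPoly p y := by
  simp [seqPoly, add_mul, Finset.sum_add_distrib]

theorem seqPoly_mul_left (p : ℕ) (a : R) (x : ℕ → R) :
    seqPoly p (fun r => a * x r) = C a * seqPoly p x := by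
  simp [seqPoly, Finset.mul_sum, mul_assoc]

theorem seqPoly_mul_right (p : ℕ) (a : R) (x : ℕ → R) :
    seqPoly p (fun r => x r * a) = seqPoly p x * C a := by
  simp [seqPoly, Finset.sum_mul, mul_assoc, X_pow_mul]

theorem seqPoly_succ {p : ℕ} {x : ℕ → R} (h : x (p + 1) = 0) :
    seqPoly p (fun r => x (r + 1)) = X * seqPoly p x - C (x 0) * X ^ (p + 1) := by
  rw [seqPoly, Finset.sum_range_succ, h, C_0, zero_mul, add_zero, seqPoly, Finset.mul_sum,
    Finset.sum_range_succ' _ p, eq_sub_iff_add_eq]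
  congr 1
  · refine Finset.sum_congr rfl fun r hr => ?_
    rw [Finset.mem_range] at hr
    rw [← mul_assoc, X_mul_C, mul_assoc, ← pow_succ', show p - (r + 1) + 1 = p - r by omega]
  · rw [← mul_assoc, X_mul_C, mul_assoc, ← pow_succ', Nat.sub_zero]

theorem RTT.seqPoly_commutator {x y z w : ℕ → R} (h : RTT x y z w) {p : ℕ}
    (hx : ∀ a, x 0 * a = a * x 0) (hxp : x (p + 1) = 0) (s : ℕ) :
    C (y (s + 1)) * seqPoly p x - seqPoly p x * C (y (s + 1)) =
      X * (C (y s) * seqPoly p x - seqPoly p x * C (y s))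
        + seqPoly p z * C (w s) - C (z s) * seqPoly p w := by
  have h1 : seqPoly p (fun r => x (r + 1) * y s - y s * x (r + 1) -
      (x r * y (s + 1) - y (s + 1) * x r)) = seqPoly p (fun r => z r * w s - z s * w r) := by
    congr 1; funext r; exact h r s
  have h2 : C (x 0) * X ^ (p + 1) * C (y s) = C (y s) * (C (x 0) * X ^ (p + 1)) := by
    rw [mul_assoc, X_pow_mul, ← mul_assoc, ← C_mul, hx, C_mul, mul_assoc]
  have h3 : C (y s) * (X * seqPoly p x) = X * (C (y s) * seqPoly p x) := by
    rw [← mul_assoc, ← X_mul, mul_assoc]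
  simp only [seqPoly_sub] at h1
  rw [seqPoly_mul_right _ _ (fun r => x (r + 1)), seqPoly_mul_left _ _ (fun r => x (r + 1)),
    seqPoly_mul_right, seqPoly_mul_left, seqPoly_mul_right, seqPoly_mul_left,
    seqPoly_succ hxp] at h1
  linear_combination (norm := noncomm_ring) h1 + h2 + h3

variable (R) in
/-- The substitution `X ↦ X - 1` as a ring endomorphism. -/
noncomputable def shiftHom : R[X] →+* R[X] :=
  eval₂RingHom' C (X - 1) fun a => (commute_X (C a)).symm.sub_right (Commute.one_right _)

theorem shiftHom_apply (q : R[X]) : shiftHom R q = q.comp (X - 1) := rfl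

@[simp] theorem shiftHom_C (a : R) : shiftHom R (C a) = C a := by
  simp [shiftHom_apply]

@[simp] theorem shiftHom_X : shiftHom R X = X - 1 := by
  simp [shiftHom_apply]

theorem shiftHom_injective : Function.Injective (shiftHom R) := by
  let g : R[X] →+* R[X] :=
    eval₂RingHom' C (X + 1) fun a => (commute_X (C a)).symm.add_right (Commute.one_right _)
  have hX : g X = X + 1 := eval₂_X _ _
  have hC : ∀ a, g (C a) = C a := fun a => eval₂_C _ _
  have hg : g.comp (shiftHom R) = RingHom.id _ := by
    refine ringHom_ext (fun a => ?_) ?_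
    · simp [hC]
    · simp [hX]
  exact Function.LeftInverse.injective fun q => congrArg (fun f : R[X] →+* R[X] => f q) hg

theorem monic_shiftHom {q : R[X]} (h : q.Monic) : (shiftHom R q).Monic := by
  nontriviality R
  exact h.comp (by simpa using monic_X_sub_C (1 : R)) (by
    have := natDegree_X_sub_C (1 : R)
    rw [C_1] at this
    simp [this])

theorem RTT.shift_commutator {x y z w : ℕ → R} (h : RTT x y z w) {p : ℕ}
    (hx : ∀ a, x 0 * a = a * x 0) (hxp : x (p + 1) = 0)
    (hy : ∀ a, y 0 * a = a * y 0) (hyp : y (p + 1) = 0) :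
    seqPoly p x * shiftHom R (seqPoly p y) - shiftHom R (seqPoly p y) * seqPoly p x =
      seqPoly p z * shiftHom R (seqPoly p w) - shiftHom R (seqPoly p z) * seqPoly p w := by
  have hsh : ∀ q : ℕ → R, shiftHom R (seqPoly p q) =
      ∑ s ∈ Finset.range (p + 1), C (q s) * (X - 1) ^ (p - s) := fun q => by
    simp [seqPoly]
  have hc : ∀ (q : R[X]) (n : ℕ), q * (X - 1) ^ n = (X - 1) ^ n * q := fun q n =>
    ((commute_X q).symm.sub_right (Commute.one_right q)).pow_right n
  have e1 : ∀ (q : ℕ → R) (f : R[X]), ∑ s ∈ Finset.range (p + 1),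
      (C (q s) * f) * (X - 1) ^ (p - s) = shiftHom R (seqPoly p q) * f := fun q f => by
    rw [hsh, Finset.sum_mul]
    exact Finset.sum_congr rfl fun s _ => by rw [mul_assoc, hc f, mul_assoc]
  have e2 : ∀ (q : ℕ → R) (f : R[X]), ∑ s ∈ Finset.range (p + 1),
      (f * C (q s)) * (X - 1) ^ (p - s) = f * shiftHom R (seqPoly p q) := fun q f => by
    rw [hsh, Finset.mul_sum]
    exact Finset.sum_congr rfl fun s _ => by rw [mul_assoc]
  have h1 : ∑ s ∈ Finset.range (p + 1),
      (C (y (s + 1)) * seqPoly p x - seqPoly p x * C (y (s + 1))) * (X - 1) ^ (p - s) =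
      ∑ s ∈ Finset.range (p + 1), (C (y s) * (X * seqPoly p x) - (X * seqPoly p x) * C (y s)
        + seqPoly p z * C (w s) - C (z s) * seqPoly p w) * (X - 1) ^ (p - s) := by
    refine Finset.sum_congr rfl fun s _ => ?_
    rw [h.seqPoly_commutator hx hxp s, ← mul_assoc (C (y s)) X, ← X_mul]
    noncomm_ring
  simp only [sub_mul, add_mul, Finset.sum_sub_distrib, Finset.sum_add_distrib] at h1
  rw [e1 (fun s => y (s + 1)), e2 (fun s => y (s + 1)), e1, e2, e1, e2, seqPoly_succ hyp] at h1
  simp only [map_sub, map_mul, map_pow, shiftHom_X, shiftHom_C] at h1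
  have h2 : C (y 0) * (X - 1) ^ (p + 1) * seqPoly p x =
      seqPoly p x * (C (y 0) * (X - 1) ^ (p + 1)) := by
    rw [mul_assoc, ← hc, ← mul_assoc, ← mul_assoc]
    congr 1
    ext n
    simp [hy]
  have h3 : seqPoly p x * (X * shiftHom R (seqPoly p y)) =
      X * seqPoly p x * shiftHom R (seqPoly p y) := by rw [← mul_assoc, ← X_mul]
  have h4 : shiftHom R (seqPoly p y) * (X * seqPoly p x) =
      X * shiftHom R (seqPoly p y) * seqPoly p x := by rw [← mul_assoc, ← X_mul]
  linear_combination (norm := noncomm_ring) h1 + h2 + h3 + h4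

end Sequences

section Completion

variable {R : Type*} [Ring R]

theorem RTT.swap' {x y z w z' w' : ℕ → R} (h : RTT x y z w) (h' : RTT w z z' w')
    (hz : ∀ a, z 0 * a = a * z 0) (hw : ∀ a, w 0 * a = a * w 0) : RTT y x w z := fun r s => by
  have h1 := h s r
  have h2 := h'.commutator_symm hw hz r s
  linear_combination (norm := noncomm_ring) h1 - h2

/-- The commutator with `e`, as an additive map. -/
def adHom (e : R) : R →+ R := AddMonoidHom.mulLeft e - AddMonoidHom.mulRight e

theorem adHom_apply (e x : R) : adHom e x = e * x - x * e := rfl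

theorem adHom_mul (e x y : R) : adHom e (x * y) = adHom e x * y + x * adHom e y := by
  simp only [adHom_apply]; noncomm_ring

theorem adHom_C_seqPoly (p : ℕ) (e : R) (x : ℕ → R) :
    adHom (C e) (seqPoly p x) = seqPoly p (fun r => adHom e (x r)) := by
  simp only [adHom_apply, seqPoly_sub, seqPoly_mul_left, seqPoly_mul_right]

theorem adHom_C_shiftHom (e : R) (q : R[X]) :
    adHom (C e) (shiftHom R q) = shiftHom R (adHom (C e) q) := by
  simp [adHom_apply]

theorem RTT.adHom_one {x y z w : ℕ → R} (h : RTT x y z w) (hx : ∀ a, x 0 * a = a * x 0) (s : ℕ) :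
    adHom (x 1) (y s) = z 0 * w s - z s * w 0 := by
  have := h 0 s
  rw [zero_add, hx, sub_self, sub_zero] at this
  exact this

theorem commute_of_rtt_self {x : ℕ → R} (h : RTT x x x x) (hx : ∀ a, x 0 * a = a * x 0)
    (r s : ℕ) : x r * x s = x s * x r := by
  rw [← sub_eq_zero]
  induction r generalizing s with
  | zero => rw [hx, sub_self]
  | succ r ih =>
    have h1 := h r s
    rw [ih, ih, sub_zero] at h1
    exact h1

/-- The matrix of sequences with rows `(d, c)` and `(b, a)`. -/
def entries (a b c d : ℕ → R) : Fin 2 → Fin 2 → ℕ → R := ![![d, c], ![b, a]]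

theorem rtt_of_commute {x : ℕ → R} (h : ∀ r s, x r * x s = x s * x r) : RTT x x x x :=
  fun r s => by
    rw [h (r + 1) s, h r (s + 1), h r s, sub_self, sub_self, sub_self, sub_self]

variable {p : ℕ} {a b c d : ℕ → R}

theorem rtt_diag (ha0 : a 0 = 1) (hb0 : b 0 = 0)
    (hd : ∀ s, adHom (b 1) (c s) = a s - d s)
    (haa : RTT a a a a) (hba : RTT b a b a) (hac : RTT a c c a) (hbc : RTT b c d a) :
    RTT a d c b := by
  have hδa : ∀ s, adHom (b 1) (a s) = -b s := fun s => by
    simpa [ha0, hb0] using hba.adHom_one (by simp [hb0]) s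
  intro r s
  have h := congrArg (adHom (b 1)) (hac r s)
  simp only [map_sub, adHom_mul, hδa, hd] at h
  linear_combination (norm := noncomm_ring) -h - hbc r s + haa r s

theorem adHom_d_eq (ha0 : a 0 = 1) (hb0 : b 0 = 0) (hc0 : c 0 = 0)
    (hd : ∀ s, adHom (b 1) (c s) = a s - d s)
    (hap : ∀ r, p < r → a r = 0) (hbp : ∀ r, p < r → b r = 0) (hcp : ∀ r, p < r → c r = 0)
    (hbb : ∀ r s, b r * b s = b s * b r)
    (hba : RTT b a b a) (hbc : RTT b c d a) {G : R[X]} (hG : adHom (C (b 1)) G = 0)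
    (hD : seqPoly p d * shiftHom R (seqPoly p a) = G + seqPoly p b * shiftHom R (seqPoly p c))
    (s : ℕ) : adHom (b 1) (d s) = b s := by
  have hb0' : ∀ x, b 0 * x = x * b 0 := by simp [hb0]
  have ha0' : ∀ x, a 0 * x = x * a 0 := by simp [ha0]
  have hc0' : ∀ x, c 0 * x = x * c 0 := by simp [hc0]
  have hδa : ∀ s, adHom (b 1) (a s) = -b s := fun s => by
    simpa [ha0, hb0] using hba.adHom_one hb0' s
  have hδb : ∀ s, adHom (b 1) (b s) = 0 := fun s => by
    rw [adHom_apply, hbb, sub_self]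
  have hdp : ∀ r, p < r → d r = 0 := fun r hr => by
    have := hd r
    rw [hcp r hr, hap r hr, map_zero, zero_sub] at this
    exact neg_eq_zero.1 this.symm
  have hPa : adHom (C (b 1)) (seqPoly p a) = -seqPoly p b := by
    rw [adHom_C_seqPoly]; simp [hδa, seqPoly]
  have hPb : adHom (C (b 1)) (seqPoly p b) = 0 := by
    rw [adHom_C_seqPoly]; simp [hδb, seqPoly]
  have hPc : adHom (C (b 1)) (seqPoly p c) = seqPoly p a - seqPoly p d := by
    rw [adHom_C_seqPoly, ← seqPoly_sub]; simp [hd]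
  have hsbc := hbc.shift_commutator hb0' (hbp _ p.lt_succ_self) hc0' (hcp _ p.lt_succ_self)
  have hsba := hba.shift_commutator hb0' (hbp _ p.lt_succ_self) ha0' (hap _ p.lt_succ_self)
  have h1 := congrArg (adHom (C (b 1))) hD
  have h2 := congrArg (adHom (C (b 1))) hsbc
  simp only [map_sub, map_add, map_neg, adHom_mul, adHom_C_shiftHom, hPa, hPb, hPc, hG] at h1 h2
  have h3 : shiftHom R (adHom (C (b 1)) (seqPoly p d) - seqPoly p b) * seqPoly p a = 0 := by
    rw [map_sub]
    linear_combination (norm := noncomm_ring) h2 + h1 - hsba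
  have h4 := (seqPoly_monic p ha0).mul_left_eq_zero_iff.1 h3
  rw [← map_zero (shiftHom R)] at h4
  have h5 := shiftHom_injective h4
  rw [adHom_C_seqPoly, ← seqPoly_sub] at h5
  rcases le_or_gt s p with hs | hs
  · exact sub_eq_zero.1 (seqPoly_eq_zero h5 hs)
  · rw [hdp s hs, hbp s hs, map_zero]

theorem adHom_d_eq_neg (ha0 : a 0 = 1) (hc0 : c 0 = 0) (hd0 : d 0 = 1)
    (hap : ∀ r, p < r → a r = 0) (hcp : ∀ r, p < r → c r = 0) (hdp : ∀ r, p < r → d r = 0)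
    (hcc : ∀ r s, c r * c s = c s * c r)
    (hca : RTT c a a c) (hac : RTT a c c a) (hbc : RTT b c d a)
    {G : R[X]} (hG : adHom (C (c 1)) G = 0)
    (hD : seqPoly p d * shiftHom R (seqPoly p a) = G + seqPoly p b * shiftHom R (seqPoly p c))
    (s : ℕ) : adHom (c 1) (d s) = -c s := by
  have ha0' : ∀ x, a 0 * x = x * a 0 := by simp [ha0]
  have hc0' : ∀ x, c 0 * x = x * c 0 := by simp [hc0]
  have hδa : ∀ s, adHom (c 1) (a s) = c s := fun s => by
    simpa [ha0, hc0] using hca.adHom_one hc0' s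
  have hδb : ∀ s, adHom (c 1) (b s) = d s - a s := fun s => by
    have := hbc s 0
    simp only [hc0, ha0, hd0] at this
    rw [adHom_apply]
    linear_combination (norm := noncomm_ring) this
  have hδc : ∀ s, adHom (c 1) (c s) = 0 := fun s => by
    rw [adHom_apply, hcc, sub_self]
  have hPa : adHom (C (c 1)) (seqPoly p a) = seqPoly p c := by
    rw [adHom_C_seqPoly]; simp [hδa]
  have hPb : adHom (C (c 1)) (seqPoly p b) = seqPoly p d - seqPoly p a := by
    rw [adHom_C_seqPoly, ← seqPoly_sub]; simp [hδb]
  have hPc : adHom (C (c 1)) (seqPoly p c) = 0 := by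
    rw [adHom_C_seqPoly]; simp [hδc, seqPoly]
  have hsac := hac.shift_commutator ha0' (hap _ p.lt_succ_self) hc0' (hcp _ p.lt_succ_self)
  have h1 := congrArg (adHom (C (c 1))) hD
  simp only [map_add, adHom_mul, adHom_C_shiftHom, hPa, hPb, hPc, hG, map_zero] at h1
  have h3 : (adHom (C (c 1)) (seqPoly p d) + seqPoly p c) * shiftHom R (seqPoly p a) = 0 := by
    linear_combination (norm := noncomm_ring) h1 - hsac
  have h4 := (monic_shiftHom (seqPoly_monic p ha0)).mul_left_eq_zero_iff.1 h3
  rw [adHom_C_seqPoly, ← seqPoly_add] at h4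
  rcases le_or_gt s p with hs | hs
  · exact eq_neg_of_add_eq_zero_left (seqPoly_eq_zero h4 hs)
  · rw [hdp s hs, hcp s hs, map_zero, neg_zero]

theorem rtt_completion (ha0 : a 0 = 1) (hb0 : b 0 = 0) (hc0 : c 0 = 0)
    (hd : ∀ s, adHom (b 1) (c s) = a s - d s)
    (hap : ∀ r, p < r → a r = 0) (hbp : ∀ r, p < r → b r = 0) (hcp : ∀ r, p < r → c r = 0)
    (haa : ∀ r s, a r * a s = a s * a r) (hbb : ∀ r s, b r * b s = b s * b r)
    (hcc : ∀ r s, c r * c s = c s * c r)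
    (hab : RTT a b a b) (hba : RTT b a b a) (hac : RTT a c c a) (hca : RTT c a a c)
    (hbc : RTT b c d a) {G : R[X]} (hGb : adHom (C (b 1)) G = 0) (hGc : adHom (C (c 1)) G = 0)
    (hD : seqPoly p d * shiftHom R (seqPoly p a) = G + seqPoly p b * shiftHom R (seqPoly p c))
    (i j k l : Fin 2) :
    RTT (entries a b c d i j) (entries a b c d k l) (entries a b c d k j)
      (entries a b c d i l) := by
  have hd0 : d 0 = 1 := by
    have := hd 0
    rw [hc0, ha0, map_zero] at this
    exact (sub_eq_zero.1 this.symm).symm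
  have hdp : ∀ r, p < r → d r = 0 := fun r hr => by
    have := hd r
    rw [hcp r hr, hap r hr, map_zero, zero_sub] at this
    exact neg_eq_zero.1 this.symm
  have ha0' : ∀ x, a 0 * x = x * a 0 := by simp [ha0]
  have hb0' : ∀ x, b 0 * x = x * b 0 := by simp [hb0]
  have hc0' : ∀ x, c 0 * x = x * c 0 := by simp [hc0]
  have hd0' : ∀ x, d 0 * x = x * d 0 := by simp [hd0]
  have had : RTT a d c b := rtt_diag ha0 hb0 hd (rtt_of_commute haa) hba hac hbc
  have hδd := adHom_d_eq ha0 hb0 hc0 hd hap hbp hcp hbb hba hbc hGb hD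
  have hεd := adHom_d_eq_neg ha0 hc0 hd0 hap hcp hdp hcc hca hac hbc hGc hD
  have hδa : ∀ s, adHom (b 1) (a s) = -b s := fun s => by
    simpa [ha0, hb0] using hba.adHom_one hb0' s
  have hδb : ∀ s, adHom (b 1) (b s) = 0 := fun s => by
    rw [adHom_apply, hbb, sub_self]
  have hεa : ∀ s, adHom (c 1) (a s) = c s := fun s => by
    simpa [ha0, hc0] using hca.adHom_one hc0' s
  have hεb : ∀ s, adHom (c 1) (b s) = d s - a s := fun s => by
    have := hbc s 0
    simp only [hc0, ha0, hd0] at this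
    rw [adHom_apply]
    linear_combination (norm := noncomm_ring) this
  have hεc : ∀ s, adHom (c 1) (c s) = 0 := fun s => by
    rw [adHom_apply, hcc, sub_self]
  have hbd : RTT b d d b := fun r s => by
    have h := congrArg (adHom (b 1)) (hbc r s)
    simp only [map_sub, adHom_mul, hδa, hδb, hδd, hd] at h
    linear_combination (norm := noncomm_ring) hba r s - h
  have hdc : RTT d c d c := fun r s => by
    have h := congrArg (adHom (c 1)) (hbc r s)
    simp only [map_sub, adHom_mul, hεa, hεb, hεc, hεd] at h
    linear_combination (norm := noncomm_ring) h + hac r s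
  have hcb : RTT c b a d := hbc.swap' had hd0' ha0'
  have hda : RTT d a b c := had.swap hcb hc0' hb0'
  have hdb : RTT d b b d := hbd.swap' hbd hd0' hb0'
  have hcd : RTT c d c d := hdc.swap hdc hd0' hc0'
  have hdd : RTT d d d d := by
    refine rtt_of_commute fun r s => ?_
    rw [← sub_eq_zero]
    induction r generalizing s with
    | zero => rw [hd0', sub_self]
    | succ r ih =>
      have h := congrArg (adHom (b 1)) (hdc r s)
      simp only [map_sub, adHom_mul, hδd, hd] at h
      linear_combination (norm := noncomm_ring) -h + hda r s + hbc r s + ih s + ih (s+1)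
  fin_cases i <;> fin_cases j <;> fin_cases k <;> fin_cases l <;>
    first
    | exact rtt_of_commute haa
    | exact rtt_of_commute hbb
    | exact rtt_of_commute hcc
    | assumption

end Completion

section QuantumDeterminant

variable {R : Type*} [Ring R]

/-- The quantum determinant of a `2 × 2` matrix of sequences. -/
noncomputable def qdet (p : ℕ) (T : Fin 2 → Fin 2 → ℕ → R) : R[X] :=
  seqPoly p (T 0 0) * shiftHom R (seqPoly p (T 1 1)) -
    seqPoly p (T 1 0) * shiftHom R (seqPoly p (T 0 1))

variable {p : ℕ} {T : Fin 2 → Fin 2 → ℕ → R}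

theorem adHom_qdet_T11 (h0 : ∀ i j, T i j 0 = if i = j then 1 else 0)
    (hp : ∀ i j r, p < r → T i j r = 0)
    (h : ∀ i j k l, RTT (T i j) (T k l) (T k j) (T i l)) (s : ℕ) :
    adHom (C (T 1 1 s)) (qdet p T) = 0 := by
  have hc : ∀ i j x, T i j 0 * x = x * T i j 0 := fun i j x => by
    rw [h0]; split_ifs <;> simp
  have hp' : ∀ i j, T i j (p + 1) = 0 := fun i j => hp i j _ p.lt_succ_self
  have hX : ∀ q : R[X], q * X = X * q := fun q => (X_mul).symm
  have haa : ∀ s, adHom (C (T 1 1 s)) (seqPoly p (T 1 1)) = 0 := fun s => by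
    rw [adHom_C_seqPoly]
    simp [seqPoly, adHom_apply, commute_of_rtt_self (h 1 1 1 1) (hc 1 1) s]
  induction s with
  | zero => simp [h0, adHom_apply]
  | succ s ih =>
    have h1 := (h 0 0 1 1).seqPoly_commutator (hc 0 0) (hp' 0 0) s
    have h2 := (h 1 0 1 1).seqPoly_commutator (hc 1 0) (hp' 1 0) s
    have h3 := congrArg (shiftHom R)
      ((h 0 1 1 1).seqPoly_commutator (hc 0 1) (hp' 0 1) s)
    have h4 := (h 0 1 1 1).shift_commutator (hc 0 1) (hp' 0 1) (hc 1 1) (hp' 1 1)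
    have h5 : adHom (C (T 0 1 s)) (seqPoly p (T 1 1)) +
        adHom (C (T 1 1 s)) (seqPoly p (T 0 1)) = 0 := by
      rw [adHom_C_seqPoly, adHom_C_seqPoly, ← seqPoly_add]
      have : ∀ r, adHom (T 0 1 s) (T 1 1 r) + adHom (T 1 1 s) (T 0 1 r) = 0 := fun r => by
        have := (h 0 1 1 1).commutator_symm (hc 0 1) (hc 1 1) s r
        simp only [adHom_apply]
        linear_combination (norm := noncomm_ring) this
      simp [this, seqPoly]
    replace h5 := congrArg (shiftHom R) h5
    have h6 := haa s
    have h7 := haa (s + 1)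
    apply_fun shiftHom R at h6 h7
    simp only [← adHom_apply] at h1 h2 h3
    simp only [map_add, map_sub, map_mul, shiftHom_X, shiftHom_C, map_zero,
      ← adHom_C_shiftHom] at h3 h5 h6 h7
    simp only [qdet, map_sub, adHom_mul, h1, h2, h3, h6, h7] at ih ⊢
    simp only [adHom_apply] at ih h5 ⊢
    linear_combination (norm := skip) X * ih + seqPoly p (T 1 0) * h5 - C (T 1 0 s) * h4
      - hX (seqPoly p (T 1 0)) * (adHom (C (T 1 1 s)) (shiftHom R (seqPoly p (T 0 1))))
    simp only [adHom_apply]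
    noncomm_ring

theorem adHom_qdet (h0 : ∀ i j, T i j 0 = if i = j then 1 else 0)
    (hp : ∀ i j r, p < r → T i j r = 0)
    (h : ∀ i j k l, RTT (T i j) (T k l) (T k j) (T i l)) (i j : Fin 2) (s : ℕ) :
    adHom (C (T i j s)) (qdet p T) = 0 := by
  have hc : ∀ i j x, T i j 0 * x = x * T i j 0 := fun i j x => by
    rw [h0]; split_ifs <;> simp
  have hp' : ∀ i j, T i j (p + 1) = 0 := fun i j => hp i j _ p.lt_succ_self
  have had : ∀ i j k l s, adHom (T i j 1) (T k l s) =
      T k j 0 * T i l s - T k j s * T i l 0 := fun i j k l s =>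
    (h i j k l).adHom_one (hc i j) s
  have key : ∀ i j k l, adHom (C (T i j 1)) (seqPoly p (T k l)) =
      C (T k j 0) * seqPoly p (T i l) - seqPoly p (T k j) * C (T i l 0) := fun i j k l => by
    simp only [adHom_C_seqPoly, had, seqPoly_sub, seqPoly_mul_left, seqPoly_mul_right]
  have hb : Commute (C (T 1 0 1)) (qdet p T) := by
    refine sub_eq_zero.1 ?_
    have h4 := (h 1 0 0 0).shift_commutator (hc 1 0) (hp' 1 0) (hc 0 0) (hp' 0 0)
    rw [← adHom_apply, qdet]
    simp only [map_sub, adHom_mul, adHom_C_shiftHom, key, h0]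
    simp
    linear_combination (norm := noncomm_ring) h4
  have hcc : Commute (C (T 0 1 1)) (qdet p T) := by
    refine sub_eq_zero.1 ?_
    have h4 := (h 0 1 1 1).shift_commutator (hc 0 1) (hp' 0 1) (hc 1 1) (hp' 1 1)
    rw [← adHom_apply, qdet]
    simp only [map_sub, adHom_mul, adHom_C_shiftHom, key, h0]
    simp
    linear_combination (norm := noncomm_ring) -h4
  have ha : ∀ s, Commute (C (T 1 1 s)) (qdet p T) := fun s =>
    sub_eq_zero.1 (adHom_qdet_T11 h0 hp h s)
  have hb' : ∀ s, Commute (C (T 1 0 s)) (qdet p T) := fun s => by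
    have := had 1 0 1 1 s
    rw [adHom_apply] at this
    have e : T 1 0 s = T 1 1 s * T 1 0 1 - T 1 0 1 * T 1 1 s := by
      simp [h0] at this
      linear_combination (norm := noncomm_ring) this
    rw [e, C_sub, C_mul, C_mul]
    exact ((ha s).mul_left hb).sub_left (hb.mul_left (ha s))
  have hc' : ∀ s, Commute (C (T 0 1 s)) (qdet p T) := fun s => by
    have := had 0 1 1 1 s
    rw [adHom_apply] at this
    have e : T 0 1 s = T 0 1 1 * T 1 1 s - T 1 1 s * T 0 1 1 := by
      simp [h0] at this
      linear_combination (norm := noncomm_ring) -this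
    rw [e, C_sub, C_mul, C_mul]
    exact (hcc.mul_left (ha s)).sub_left ((ha s).mul_left hcc)
  have hd' : ∀ s, Commute (C (T 0 0 s)) (qdet p T) := fun s => by
    have := had 1 0 0 1 s
    rw [adHom_apply] at this
    have e : T 0 0 s = T 1 1 s - (T 1 0 1 * T 0 1 s - T 0 1 s * T 1 0 1) := by
      simp [h0] at this
      linear_combination (norm := noncomm_ring) this
    rw [e, C_sub, C_sub, C_mul, C_mul]
    exact (ha s).sub_left ((hb.mul_left (hc' s)).sub_left ((hc' s).mul_left hb))
  refine sub_eq_zero.2 ?_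
  fin_cases i <;> fin_cases j
  exacts [hd' s, hc' s, hb' s, ha s]

theorem commute_T_qdet_coeff (h0 : ∀ i j, T i j 0 = if i = j then 1 else 0)
    (hp : ∀ i j r, p < r → T i j r = 0)
    (h : ∀ i j k l, RTT (T i j) (T k l) (T k j) (T i l)) (i j : Fin 2) (s n : ℕ) :
    T i j s * (qdet p T).coeff n = (qdet p T).coeff n * T i j s := by
  have := congrArg (fun q => coeff q n) (adHom_qdet h0 hp h i j s)
  simpa [adHom_apply, sub_eq_zero] using this

theorem commute_qdet_coeff (h0 : ∀ i j, T i j 0 = if i = j then 1 else 0)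
    (hp : ∀ i j r, p < r → T i j r = 0)
    (h : ∀ i j k l, RTT (T i j) (T k l) (T k j) (T i l)) (m n : ℕ) :
    (qdet p T).coeff m * (qdet p T).coeff n = (qdet p T).coeff n * (qdet p T).coeff m := by
  have h1 : ∀ i j, adHom (C ((qdet p T).coeff m)) (seqPoly p (T i j)) = 0 := fun i j => by
    rw [adHom_C_seqPoly]
    simp [adHom_apply, commute_T_qdet_coeff h0 hp h, seqPoly]
  have h2 : adHom (C ((qdet p T).coeff m)) (qdet p T) = 0 := by
    nth_rw 2 [qdet]
    simp only [map_sub, adHom_mul, adHom_C_shiftHom, h1, map_zero, zero_mul, mul_zero, add_zero,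
      sub_zero]
  have := congrArg (fun q => coeff q n) h2
  simpa [adHom_apply, sub_eq_zero] using this

end QuantumDeterminant

section Yangian

variable (K : Type) [Field K] (p : ℕ)

theorem tY_zero (i j : Fin 2) : tY K p i j 0 = if i = j then 1 else 0 := by
  rw [tY, tF, dif_pos rfl]
  split_ifs <;> simp

theorem tY_eq_zero_of_lt (i j : Fin 2) (r : ℕ) (h : p < r) : tY K p i j r = 0 := by
  rw [tY, tF, dif_neg (by omega), dif_neg (by omega), map_zero]

theorem tY_RTT (i j k l : Fin 2) :
    RTT (tY K p i j) (tY K p k l) (tY K p k j) (tY K p i l) := by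
  refine RTT.of_commutator_eq fun r s => ?_
  rcases Nat.eq_zero_or_pos r with rfl | hr
  · rw [rttSum_zero_left, tY_zero]
    split_ifs <;> simp
  rcases Nat.eq_zero_or_pos s with rfl | hs
  · rw [rttSum_zero_right, tY_zero K p k l]
    split_ifs <;> simp
  by_cases hr' : r ≤ p
  · by_cases hs' : s ≤ p
    · have := RingQuot.mkAlgHom_rel K (YRel.rel (K := K) (p := p) i j k l r s hr hr' hs hs')
      simp only [map_sub, map_mul, map_sum] at this
      exact this
    · rw [tY_eq_zero_of_lt K p k l s (not_le.1 hs'), rttSum_eq_zero_of_lt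
        (tY_eq_zero_of_lt K p k j) (tY_eq_zero_of_lt K p i l) (Or.inr (not_le.1 hs'))]
      simp
  · rw [tY_eq_zero_of_lt K p i j r (not_le.1 hr'), rttSum_eq_zero_of_lt
      (tY_eq_zero_of_lt K p k j) (tY_eq_zero_of_lt K p i l) (Or.inl (not_le.1 hr'))]
    simp

theorem TY_eq_seqPoly (i j : Fin 2) : TY K p i j = seqPoly p (tY K p i j) := by
  rw [TY, seqPoly, Finset.range_eq_Ico, Finset.sum_eq_sum_Ico_succ_bot (by omega), tY_zero]
  congr 1
  split_ifs <;> simp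

theorem DY_eq_qdet : DY K p = qdet p (tY K p) := by
  simp only [DY, qdet, TY_eq_seqPoly, shiftHom_apply]

/-- The generators of `Γ`. -/
noncomputable def gamGen : Fin p ⊕ Fin (2 * p) → Yp K p :=
  Sum.elim (fun i => tY K p 1 1 (i + 1)) fun j => dY K p (j + 1)

theorem gamGen_commute (x y : Fin p ⊕ Fin (2 * p)) :
    gamGen K p x * gamGen K p y = gamGen K p y * gamGen K p x := by
  have h0 := tY_zero K p
  have hp := tY_eq_zero_of_lt K p
  have h := tY_RTT K p
  rcases x with x | x <;> rcases y with y | y <;>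
    simp only [gamGen, Sum.elim_inl, Sum.elim_inr, dY, DY_eq_qdet]
  · exact commute_of_rtt_self (h 1 1 1 1) (by simp [h0]) _ _
  · exact commute_T_qdet_coeff h0 hp h _ _ _ _
  · exact (commute_T_qdet_coeff h0 hp h _ _ _ _).symm
  · exact commute_qdet_coeff h0 hp h _ _

theorem Gam_le_adjoin_range : Gam K p ≤ Algebra.adjoin K (Set.range (gamGen K p)) := by
  refine Algebra.adjoin_mono ?_
  rintro _ (⟨k, hk, rfl⟩ | ⟨k, hk, rfl⟩) <;> rw [Finset.mem_Icc] at hk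
  · exact ⟨Sum.inl ⟨k - 1, by omega⟩, by simp [gamGen, show k - 1 + 1 = k by omega]⟩
  · exact ⟨Sum.inr ⟨k - 1, by omega⟩, by simp [gamGen, show k - 1 + 1 = k by omega]⟩

end Yangian

open scoped IsMulCommutative in
theorem exists_algHom_mvPolynomial {K A σ : Type*} [CommRing K] [Ring A] [Algebra K A]
    (g : σ → A) (hg : ∀ x y, g x * g y = g y * g x) :
    ∃ φ : MvPolynomial σ K →ₐ[K] A, (∀ i, φ (MvPolynomial.X i) = g i) ∧
      ∀ a ∈ Algebra.adjoin K (Set.range g), ∃ P, φ P = a := by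
  have := Algebra.isMulCommutative_adjoin K (s := Set.range g)
    (by rintro _ ⟨x, rfl⟩ _ ⟨y, rfl⟩; exact hg x y)
  let g' : σ → Algebra.adjoin K (Set.range g) := fun i => ⟨g i, Algebra.subset_adjoin ⟨i, rfl⟩⟩
  let ψ : MvPolynomial σ K →ₐ[K] Algebra.adjoin K (Set.range g) := MvPolynomial.aeval g'
  have hψ : ∀ i, ψ (MvPolynomial.X i) = g' i := MvPolynomial.aeval_X g'
  let φ : MvPolynomial σ K →ₐ[K] A := (Algebra.adjoin K (Set.range g)).val.comp ψ
  have hφ : ∀ i, φ (MvPolynomial.X i) = g i := fun i => by simp [φ, hψ, g']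
  refine ⟨φ, hφ, fun a ha => ?_⟩
  have : Algebra.adjoin K (Set.range g) ≤ φ.range :=
    Algebra.adjoin_le (by rintro _ ⟨x, rfl⟩; exact ⟨_, hφ x⟩)
  exact this ha

section Lagrange

variable {F : Type*} [Field F] {p : ℕ}

/-- The product `∏_m (u + y_m)`. -/
def rootProd (y : Fin p → F) (u : F) : F := ∏ m, (u + y m)

/-- The product `∏_{m ≠ i} (u + y_m)`. -/
def lagNum (y : Fin p → F) (i : Fin p) (u : F) : F := ∏ m ∈ Finset.univ.erase i, (u + y m)

/-- The Lagrange polynomial `∏_{m ≠ i} (u + y_m) / (y_m - y_i)`. -/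
def lag (y : Fin p → F) (i : Fin p) (u : F) : F := lagNum y i u * (lagNum y i (-y i))⁻¹

/-- The product `∏_{m ≠ i, j} (u + y_m)`. -/
def lagPair (y : Fin p → F) (i j : Fin p) (u : F) : F :=
  ∏ m ∈ (Finset.univ.erase i).erase j, (u + y m)

variable (y : Fin p → F)

theorem rootProd_eq (i : Fin p) (u : F) : rootProd y u = (u + y i) * lagNum y i u :=
  (Finset.mul_prod_erase _ _ (Finset.mem_univ i)).symm

theorem lagNum_add_single (i : Fin p) (s u : F) :
    lagNum (y + Pi.single i s) i u = lagNum y i u :=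
  Finset.prod_congr rfl fun m hm => by simp [Finset.ne_of_mem_erase hm]

theorem lagNum_eq {i j : Fin p} (h : i ≠ j) (u : F) :
    lagNum y i u = (u + y j) * lagPair y i j u :=
  (Finset.mul_prod_erase _ (fun m => u + y m) (by simp [h.symm])).symm

theorem lagPair_comm (i j : Fin p) (u : F) : lagPair y i j u = lagPair y j i u := by
  rw [lagPair, lagPair, Finset.erase_right_comm]

theorem lagPair_add_single_left (i j : Fin p) (s u : F) :
    lagPair (y + Pi.single i s) i j u = lagPair y i j u :=
  Finset.prod_congr rfl fun m hm => by
    simp [Finset.ne_of_mem_erase (Finset.mem_of_mem_erase hm)]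

theorem lagPair_add_single_right (i j : Fin p) (s u : F) :
    lagPair (y + Pi.single j s) i j u = lagPair y i j u :=
  Finset.prod_congr rfl fun m hm => by simp [Finset.ne_of_mem_erase hm]

theorem lag_add_single (i : Fin p) (s u : F) :
    lag (y + Pi.single i s) i u = lagNum y i u * (lagNum y i (-(y i + s)))⁻¹ := by
  simp [lag, lagNum_add_single]

theorem lag_add_single_of_ne {i j : Fin p} (h : i ≠ j) (s t u : F) :
    lag (y + Pi.single i s + Pi.single j t) j u =
      (u + y i + s) * lagPair y i j u *
        ((y i - y j + s - t)⁻¹ * (lagPair y i j (-(y j + t)))⁻¹) := by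
  rw [lag_add_single, lagNum_eq _ h.symm, lagNum_eq _ h.symm, lagPair_comm _ j i,
    lagPair_comm _ j i, lagPair_add_single_left, lagPair_add_single_left, mul_inv]
  simp only [Pi.add_apply, Pi.single_eq_same, Pi.single_eq_of_ne h.symm, add_zero]
  rw [show -(y j + t) + (y i + s) = y i - y j + s - t by ring, add_assoc]

theorem lag_add_single_eq {i j : Fin p} (h : i ≠ j) (t u : F) :
    lag (y + Pi.single j t) j u = (u + y i) * lagPair y i j u *
        ((y i - y j - t)⁻¹ * (lagPair y i j (-(y j + t)))⁻¹) := by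
  simpa using lag_add_single_of_ne y h 0 t u

theorem lag_antisymm {i j : Fin p} (hij : i ≠ j) (s u v : F)
    (h0 : y i - y j ≠ 0) (h1 : y i - y j + s ≠ 0) (h2 : y j - y i + s ≠ 0) :
    lag (y + Pi.single i s) i u * lag (y + Pi.single i s + Pi.single j s) j v -
      lag (y + Pi.single i s) i v * lag (y + Pi.single i s + Pi.single j s) j u +
    (lag (y + Pi.single j s) j u * lag (y + Pi.single j s + Pi.single i s) i v -
      lag (y + Pi.single j s) j v * lag (y + Pi.single j s + Pi.single i s) i u) = 0 := by
  have h0' : y j - y i ≠ 0 := fun h => h0 (by linear_combination -h)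
  have h1' : y i - y j - s ≠ 0 := fun h => h2 (by linear_combination -h)
  have h2' : y j - y i - s ≠ 0 := fun h => h1 (by linear_combination -h)
  simp only [lag_add_single_of_ne y hij, lag_add_single_of_ne y hij.symm, lag_add_single_eq y hij,
    lag_add_single_eq y hij.symm, lagPair_comm y j i]
  generalize (lagPair y i j (-(y j + s)))⁻¹ = a
  generalize (lagPair y i j (-(y i + s)))⁻¹ = b
  generalize lagPair y i j u = c
  generalize lagPair y i j v = d
  rw [show y i - y j + s - s = y i - y j by ring, show y j - y i + s - s = y j - y i by ring]
  have h3 : (y j - y i)⁻¹ = -(y i - y j)⁻¹ := by rw [← inv_neg, neg_sub]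
  rw [h3]
  field_simp
  ring

theorem rootProd_add_single_pair {i j : Fin p} (hij : i ≠ j) (s t u : F) :
    rootProd (y + Pi.single i s + Pi.single j t) u =
      (u + y i + s) * (u + y j + t) * lagPair y i j u := by
  rw [rootProd_eq _ i, lagNum_eq _ hij, lagPair_add_single_right, lagPair_add_single_left]
  simp [Pi.single_eq_of_ne hij, Pi.single_eq_of_ne hij.symm]
  ring

theorem rootProd_add_single (i : Fin p) (s u : F) :
    rootProd (y + Pi.single i s) u = (u + y i + s) * lagNum y i u := by
  rw [rootProd_eq _ i, lagNum_add_single]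
  simp [add_assoc]

/-- Up to the weight, the coefficient of the commutator of a raising and a lowering operator
for a pair of distinct indices. -/
theorem lag_commutator {i j : Fin p} (hij : i ≠ j) (u v : F) :
    lag (y + Pi.single i (-1)) i u * lag (y + Pi.single i (-1) + Pi.single j 1) j v -
      lag (y + Pi.single j 1) j v * lag (y + Pi.single j 1 + Pi.single i (-1)) i u =
    -(u + v + y i + y j) * (lagPair y i j u * lagPair y i j v *
      ((y j - y i + 1)⁻¹ * (y i - y j - 2)⁻¹ *
        (lagPair y i j (-(y j + 1)))⁻¹ * (lagPair y i j (-(y i - 1)))⁻¹)) := by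
  simp only [lag_add_single_of_ne y hij, lag_add_single_of_ne y hij.symm,
    lag_add_single_eq y hij, lag_add_single_eq y hij.symm, lagPair_comm y j i]
  rw [show y j - y i - -1 = y j - y i + 1 by ring, show y i - y j + -1 - 1 = y i - y j - 2 by ring,
    show y i - y j - 1 = -(y j - y i + 1) by ring,
    show y j - y i + 1 - -1 = -(y i - y j - 2) by ring, inv_neg, inv_neg,
    show -(y i + -1) = -(y i - 1) by ring]
  ring

end Lagrange

section SeqEval

variable {F M R : Type*} [Field F] [AddCommGroup M] [Module F M] [Ring R] [Algebra F R]

theorem eq_zero_of_forall_sum_pow_smul [Infinite F] {n : ℕ} {e : ℕ → M}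
    (h : ∀ u : F, ∑ r ∈ Finset.range n, u ^ r • e r = 0) {r : ℕ} (hr : r < n) : e r = 0 := by
  refine (Module.forall_dual_apply_eq_zero_iff F (e r)).1 fun φ => ?_
  have h1 : ∑ r ∈ Finset.range n, C (φ (e r)) * X ^ r = 0 := by
    refine Polynomial.funext fun u => ?_
    have := congrArg φ (h u)
    simp only [map_sum, map_smul, smul_eq_mul, map_zero] at this
    simp only [eval_finsetSum, eval_C_mul, eval_X_pow, eval_zero, ← this]
    exact Finset.sum_congr rfl fun r _ => mul_comm _ _
  have := congrArg (fun q => coeff q r) h1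
  simpa [hr] using this

/-- The value at `u` of `∑_{r ≤ p} x_r u^{p-r}`. -/
def seqEval (p : ℕ) (x : ℕ → M) (u : F) : M := ∑ r ∈ Finset.range (p + 1), u ^ (p - r) • x r

theorem seqEval_sub (p : ℕ) (x y : ℕ → M) (u : F) :
    seqEval p (fun r => x r - y r) u = seqEval p x u - seqEval p y u := by
  simp [seqEval, smul_sub]

theorem seqEval_mul_left (p : ℕ) (a : R) (x : ℕ → R) (u : F) :
    seqEval p (fun r => a * x r) u = a * seqEval p x u := by
  simp [seqEval, Finset.mul_sum]

theorem seqEval_mul_right (p : ℕ) (a : R) (x : ℕ → R) (u : F) :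
    seqEval p (fun r => x r * a) u = seqEval p x u * a := by
  simp [seqEval, Finset.sum_mul]

theorem seqEval_eq_zero [Infinite F] {p : ℕ} {x : ℕ → M} (h : ∀ u : F, seqEval p x u = 0)
    {r : ℕ} (hr : r ≤ p) : x r = 0 := by
  have := eq_zero_of_forall_sum_pow_smul (F := F) (n := p + 1) (e := fun r => x (p - r))
    (fun u => by
      rw [← h u, seqEval, ← Finset.sum_range_reflect]
      refine Finset.sum_congr rfl fun r hr => ?_
      rw [Finset.mem_range] at hr
      rw [show p + 1 - 1 - r = p - r by omega, show p - (p - r) = r by omega])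
    (show p - r < p + 1 by omega)
  simpa [show p - (p - r) = r by omega] using this

theorem seqEval_succ {p : ℕ} {x : ℕ → M} (h : x (p + 1) = 0) (u : F) :
    seqEval p (fun r => x (r + 1)) u = u • seqEval p x u - u ^ (p + 1) • x 0 := by
  rw [seqEval, Finset.sum_range_succ, h, smul_zero, add_zero, seqEval, Finset.smul_sum,
    Finset.sum_range_succ' _ p, eq_sub_iff_add_eq]
  congr 1
  · refine Finset.sum_congr rfl fun r hr => ?_
    rw [Finset.mem_range] at hr
    rw [smul_smul, ← pow_succ', show p - (r + 1) + 1 = p - r by omega]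
  · rw [smul_smul, ← pow_succ', Nat.sub_zero]

theorem RTT.of_seqEval [Infinite F] {p : ℕ} {x y z w : ℕ → R}
    (hx0 : ∀ a, x 0 * a = a * x 0) (hy0 : ∀ a, y 0 * a = a * y 0)
    (hx : ∀ r, p < r → x r = 0) (hy : ∀ r, p < r → y r = 0)
    (hz : ∀ r, p < r → z r = 0) (hw : ∀ r, p < r → w r = 0)
    (h : ∀ u v : F, (u - v) • (seqEval p x u * seqEval p y v - seqEval p y v * seqEval p x u) =
      seqEval p z u * seqEval p w v - seqEval p z v * seqEval p w u) : RTT x y z w := by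
  intro r s
  by_cases hr : r ≤ p
  swap
  · rw [not_le] at hr
    simp [hx r hr, hx (r + 1) (by omega), hz r hr, hw r hr]
  by_cases hs : s ≤ p
  swap
  · rw [not_le] at hs
    simp [hy s hs, hy (s + 1) (by omega), hz s hs, hw s hs]
  rw [← sub_eq_zero]
  refine seqEval_eq_zero (F := F) (p := p) (x := fun s => x (r + 1) * y s - y s * x (r + 1) -
    (x r * y (s + 1) - y (s + 1) * x r) - (z r * w s - z s * w r)) (fun v => ?_) hs
  refine seqEval_eq_zero (F := F) (p := p) (x := fun r => seqEval p (fun s =>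
    x (r + 1) * y s - y s * x (r + 1) -
    (x r * y (s + 1) - y (s + 1) * x r) - (z r * w s - z s * w r)) v) (fun u => ?_) hr
  simp only [seqEval_sub, seqEval_mul_left, seqEval_mul_right]
  rw [seqEval_succ (hx _ p.lt_succ_self), seqEval_succ (hy _ p.lt_succ_self),
    sub_eq_zero, ← h u v]
  have h1 := hx0 (seqEval p y v)
  have h2 := hy0 (seqEval p x u)
  simp only [sub_mul, mul_sub, smul_mul_assoc, mul_smul_comm, h1, h2]
  module

variable (R) in
/-- Evaluation of polynomials over an `F`-algebra at a scalar, as a ring homomorphism. -/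
noncomputable def evalScalar (u : F) : R[X] →+* R :=
  eval₂RingHom' (RingHom.id R) (algebraMap F R u) fun a => (Algebra.commutes u a).symm

theorem evalScalar_C (u : F) (a : R) : evalScalar R u (C a) = a :=
  eval₂_C _ _

theorem evalScalar_X (u : F) : evalScalar R u X = algebraMap F R u :=
  eval₂_X _ _

theorem evalScalar_seqPoly (p : ℕ) (x : ℕ → R) (u : F) :
    evalScalar R u (seqPoly p x) = seqEval p x u := by
  simp only [seqPoly, map_sum, map_mul, map_pow, evalScalar_C, evalScalar_X, seqEval]
  exact Finset.sum_congr rfl fun r _ => by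
    rw [← map_pow, ← Algebra.commutes, Algebra.smul_def]

theorem evalScalar_shiftHom (u : F) (q : R[X]) :
    evalScalar R u (shiftHom R q) = evalScalar R (u - 1) q := by
  have : (evalScalar R u).comp (shiftHom R) = evalScalar R (u - 1) := by
    refine ringHom_ext (fun a => ?_) ?_
    · simp [evalScalar_C]
    · simp [evalScalar_X]
  exact congrArg (fun f : R[X] →+* R => f q) this

theorem eq_of_forall_evalScalar_eq [Infinite F] {q q' : R[X]}
    (h : ∀ u : F, evalScalar R u q = evalScalar R u q') : q = q' := by
  rw [← sub_eq_zero]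
  ext n
  by_cases hn : n < (q - q').natDegree + 1
  · refine eq_zero_of_forall_sum_pow_smul (F := F) (e := (q - q').coeff) (fun u => ?_) hn
    have h1 : evalScalar R u (q - q') = 0 := by rw [map_sub, h, sub_self]
    rw [as_sum_range_C_mul_X_pow (q - q')] at h1
    rw [← h1, map_sum]
    exact Finset.sum_congr rfl fun r _ => by
      rw [map_mul, map_pow, evalScalar_C, evalScalar_X, ← map_pow, ← Algebra.commutes,
        Algebra.smul_def]
  · exact coeff_eq_zero_of_natDegree_lt (by omega)

end SeqEval

section Commutators

variable {F : Type*} [Field F] {p : ℕ}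

/-- The leading coefficient of the Lagrange polynomial `lag y i`. -/
def lagLead (y : Fin p → F) (i : Fin p) : F := (lagNum y i (-y i))⁻¹

variable (y : Fin p → F)

theorem lag_eq (i : Fin p) (u : F) : lag y i u = lagNum y i u * lagLead y i := rfl

theorem lagLead_add_single_of_ne {i j : Fin p} (h : i ≠ j) (s t : F) :
    lagLead (y + Pi.single i s + Pi.single j t) j =
      (y i - y j + s - t)⁻¹ * (lagPair y i j (-(y j + t)))⁻¹ := by
  rw [lagLead, lagNum_add_single, lagNum_eq _ h.symm, lagPair_comm _ j i,
    lagPair_add_single_left, mul_inv]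
  simp only [Pi.add_apply, Pi.single_eq_same, Pi.single_eq_of_ne h.symm, add_zero]
  rw [show -(y j + t) + (y i + s) = y i - y j + s - t by ring]

theorem lagLead_add_single_eq {i j : Fin p} (h : i ≠ j) (t : F) :
    lagLead (y + Pi.single j t) j =
      (y i - y j - t)⁻¹ * (lagPair y i j (-(y j + t)))⁻¹ := by
  simpa using lagLead_add_single_of_ne y h 0 t

variable (g : F → F)

/-- The coefficients of the commutator of a raising operator and a weighted lowering operator. -/
def ladderComm (i j : Fin p) (u v : F) : F :=
  lag (y + Pi.single i (-1)) i u * (g ((y + Pi.single i (-1) + Pi.single j 1 : Fin p → F) j) *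
      lag (y + Pi.single i (-1) + Pi.single j 1) j v) -
    g ((y + Pi.single j 1 : Fin p → F) j) * lag (y + Pi.single j 1) j v *
      lag (y + Pi.single j 1 + Pi.single i (-1)) i u

/-- The leading coefficient of `ladderComm` in its first variable. -/
def ladderCommLead (i j : Fin p) (v : F) : F :=
  lagLead (y + Pi.single i (-1)) i * (g ((y + Pi.single i (-1) + Pi.single j 1 : Fin p → F) j) *
      lag (y + Pi.single i (-1) + Pi.single j 1) j v) -
    g ((y + Pi.single j 1 : Fin p → F) j) * lag (y + Pi.single j 1) j v *
      lagLead (y + Pi.single j 1 + Pi.single i (-1)) i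

theorem ladderCommLead_of_ne {i j : Fin p} (hij : i ≠ j) (v : F) :
    ladderCommLead y g i j v = -(g (y j + 1) * lagPair y i j v *
      ((y j - y i + 1)⁻¹ * (y i - y j - 2)⁻¹ *
        (lagPair y i j (-(y j + 1)))⁻¹ * (lagPair y i j (-(y i - 1)))⁻¹)) := by
  simp only [ladderCommLead, lag_add_single_of_ne y hij, lagLead_add_single_of_ne y hij.symm,
    lag_add_single_eq y hij, lagLead_add_single_eq y hij.symm, lagPair_comm y j i,
    Pi.add_apply, Pi.single_eq_same, Pi.single_eq_of_ne hij.symm, add_zero]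
  rw [show y j - y i - -1 = y j - y i + 1 by ring, show y i - y j + -1 - 1 = y i - y j - 2 by ring,
    show y i - y j - 1 = -(y j - y i + 1) by ring,
    show y j - y i + 1 - -1 = -(y i - y j - 2) by ring, inv_neg, inv_neg,
    show -(y i + -1) = -(y i - 1) by ring]
  ring

theorem ladderComm_of_ne {i j : Fin p} (hij : i ≠ j) (u v : F) :
    ladderComm y g i j u v = (u + v + y i + y j) * lagPair y i j u * ladderCommLead y g i j v := by
  have h := lag_commutator y hij u v
  rw [ladderCommLead_of_ne y g hij, ladderComm]
  simp only [Pi.add_apply, Pi.single_eq_same, Pi.single_eq_of_ne hij.symm, add_zero]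
  linear_combination g (y j + 1) * h

/-- The coefficient `h_i` of `lagNum y i` in the diagonal part of the commutator. -/
def diagCoeff (i : Fin p) : F :=
  lagLead (y + Pi.single i (-1)) i * (g (y i) * lagLead y i) -
    g (y i + 1) * lagLead (y + Pi.single i 1) i * lagLead y i

theorem add_single_neg_add_single (i : Fin p) :
    y + Pi.single i (-1) + Pi.single i 1 = y := by
  rw [add_assoc, ← Pi.single_add]
  simp

theorem add_single_add_single_neg (i : Fin p) :
    y + Pi.single i 1 + Pi.single i (-1) = y := by
  rw [add_assoc, ← Pi.single_add]
  simp

theorem ladderCommLead_self (i : Fin p) (v : F) :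
    ladderCommLead y g i i v = lagNum y i v * diagCoeff y g i := by
  simp only [ladderCommLead, diagCoeff, add_single_neg_add_single, add_single_add_single_neg,
    lag_eq, lagNum_add_single, Pi.add_apply, Pi.single_eq_same]
  ring_nf

theorem ladderComm_self (i : Fin p) (u v : F) :
    ladderComm y g i i u v = lagNum y i u * ladderCommLead y g i i v := by
  simp only [ladderCommLead, ladderComm, add_single_neg_add_single, add_single_add_single_neg,
    lag_eq, lagNum_add_single]
  ring

theorem ladderComm_eq (i j : Fin p) (u v : F) :
    (u - v) * ladderComm y g i j u v =
      rootProd (y + Pi.single i (-1) + Pi.single j 1) u * ladderCommLead y g i j v -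
        rootProd (y + Pi.single i (-1) + Pi.single j 1) v * ladderCommLead y g i j u := by
  by_cases h : i = j
  · subst h
    rw [ladderComm_self, ladderCommLead_self, ladderCommLead_self, add_single_neg_add_single,
      rootProd_eq _ i, rootProd_eq _ i]
    ring
  · rw [ladderComm_of_ne _ _ h, ladderCommLead_of_ne _ _ h, ladderCommLead_of_ne _ _ h,
      rootProd_add_single_pair _ h, rootProd_add_single_pair _ h]
    ring

theorem lag_mul_lag_of_ne {i j : Fin p} (hij : i ≠ j) (u : F) :
    lag (y + Pi.single i (-1)) i u * (g ((y + Pi.single i (-1) + Pi.single j 1 : Fin p → F) j) *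
      lag (y + Pi.single i (-1) + Pi.single j 1) j (u - 1)) =
      -(rootProd (y + Pi.single i (-1) + Pi.single j 1) (u - 1) * ladderCommLead y g i j u) := by
  rw [ladderCommLead_of_ne _ _ hij, rootProd_add_single_pair _ hij, lag_add_single_of_ne y hij,
    lag_add_single_eq y hij.symm]
  simp only [lagPair_comm y j i, Pi.add_apply, Pi.single_eq_same, Pi.single_eq_of_ne hij.symm,
    add_zero]
  rw [show y j - y i - -1 = y j - y i + 1 by ring, show y i - y j + -1 - 1 = y i - y j - 2 by ring,
    show -(y i + -1) = -(y i - 1) by ring]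
  ring

/-- The polynomial with values `rootProd y`. -/
noncomputable def rootPoly : F[X] := ∏ m, (X + C (y m))

/-- The polynomial with values `lagNum y i`. -/
noncomputable def lagNumPoly (i : Fin p) : F[X] := ∏ m ∈ Finset.univ.erase i, (X + C (y m))

theorem eval_rootPoly (u : F) : (rootPoly y).eval u = rootProd y u := by
  simp [rootPoly, rootProd, eval_prod]

theorem eval_lagNumPoly (i : Fin p) (u : F) : (lagNumPoly y i).eval u = lagNum y i u := by
  simp [lagNumPoly, lagNum, eval_prod]

theorem rootPoly_monic : (rootPoly y).Monic := monic_prod_of_monic _ _ fun _ _ => monic_X_add_C _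

theorem lagNumPoly_monic (i : Fin p) : (lagNumPoly y i).Monic :=
  monic_prod_of_monic _ _ fun _ _ => monic_X_add_C _

theorem natDegree_rootPoly : (rootPoly y).natDegree = p := by
  rw [rootPoly, natDegree_prod_of_monic _ _ fun _ _ => monic_X_add_C _]
  simp

theorem natDegree_lagNumPoly (i : Fin p) : (lagNumPoly y i).natDegree = p - 1 := by
  rw [lagNumPoly, natDegree_prod_of_monic _ _ fun _ _ => monic_X_add_C _]
  simp

end Commutators

section Diagonal

variable {F : Type*} [Field F] {p : ℕ}

theorem lagNum_ne_zero {y : Fin p → F} {i : Fin p} {u : F} (h : ∀ m, m ≠ i → u + y m ≠ 0) :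
    lagNum y i u ≠ 0 :=
  Finset.prod_ne_zero_iff.2 fun m hm => h m (Finset.ne_of_mem_erase hm)

theorem lagNum_eq_zero {y : Fin p → F} {i j : Fin p} (h : j ≠ i) : lagNum y i (-y j) = 0 :=
  Finset.prod_eq_zero (Finset.mem_erase.2 ⟨h, Finset.mem_univ j⟩) (neg_add_cancel _)

theorem rootProd_eq_zero (y : Fin p → F) (j : Fin p) : rootProd y (-y j) = 0 :=
  Finset.prod_eq_zero (Finset.mem_univ j) (neg_add_cancel _)

theorem rootProd_mul_rootProd {y : Fin p → F}
    (hy : ∀ i j, i ≠ j → ∀ m : ℤ, y i - y j ≠ (m : F))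
    {γ : F[X]} (hγ : γ.Monic) (hd : γ.natDegree = 2 * p) {g : F → F}
    (hg : ∀ z, g z = -γ.eval (1 - z)) (u : F) :
    rootProd y u * rootProd y (u - 1) = γ.eval u +
      ∑ i, (ladderCommLead y g i i u * rootProd y (u - 1) +
        lag (y + Pi.single i (-1)) i u * (g (y i) * lag y i (u - 1))) := by
  have hy0 : ∀ i j, i ≠ j → y i - y j ≠ 0 := fun i j h => by simpa using hy i j h 0
  have hy1 : ∀ i j, i ≠ j → y i - y j ≠ 1 := fun i j h => by simpa using hy i j h 1
  have hX : (X - 1 : F[X]) = X - C 1 := by rw [C_1]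
  let A := rootPoly y
  let A' := A.comp (X - 1)
  let t : Fin p → F[X] := fun i => lagNumPoly y i * C (diagCoeff y g i) * A' +
    lagNumPoly y i * (lagNumPoly y i).comp (X - 1) *
      C (lagLead (y + Pi.single i (-1)) i * lagLead y i * g (y i))
  have hA' : A'.Monic := (rootPoly_monic y).comp (hX ▸ monic_X_sub_C _) (by
    rw [hX, natDegree_X_sub_C]; exact one_ne_zero)
  have hA'd : A'.natDegree = p := by
    rw [natDegree_comp, hX, natDegree_X_sub_C, natDegree_rootPoly, mul_one]
  have hLd : ∀ i, ((lagNumPoly y i).comp (X - 1)).natDegree = p - 1 := fun i => by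
    rw [natDegree_comp, hX, natDegree_X_sub_C, natDegree_lagNumPoly, mul_one]
  have heval : ∀ u, (A * A' - γ - ∑ i, t i).eval u = rootProd y u * rootProd y (u - 1) -
      γ.eval u - ∑ i, (ladderCommLead y g i i u * rootProd y (u - 1) +
        lag (y + Pi.single i (-1)) i u * (g (y i) * lag y i (u - 1))) := fun u => by
    simp only [A, A', t, eval_sub, eval_mul, eval_finsetSum, eval_comp, eval_add, eval_X, eval_C,
      eval_one, eval_rootPoly, eval_lagNumPoly, ladderCommLead_self, lag_eq, lagNum_add_single]
    congr 1
    refine Finset.sum_congr rfl fun i _ => ?_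
    ring
  have hAA : (A * A').natDegree = 2 * p := by
    rw [(rootPoly_monic y).natDegree_mul hA', natDegree_rootPoly, hA'd, two_mul]
  have hdeg : (A * A' - γ - ∑ i, t i) ∈ degreeLT F (2 * p) := by
    refine Submodule.sub_mem _ ?_ (Submodule.sum_mem _ fun i _ => ?_)
    · rw [mem_degreeLT]
      have hAm : (A * A').Monic := (rootPoly_monic y).mul hA'
      refine (degree_sub_lt_left ?_ hAm.ne_zero ?_).trans_eq ?_
      · rw [degree_eq_natDegree hAm.ne_zero, degree_eq_natDegree hγ.ne_zero, hAA, hd]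
      · rw [hAm.leadingCoeff, hγ.leadingCoeff]
      · rw [degree_eq_natDegree hAm.ne_zero, hAA]
    · have hp := i.pos
      rw [mem_degreeLT]
      refine degree_le_natDegree.trans_lt (Nat.cast_lt.2 ?_)
      refine (natDegree_add_le_of_degree_le (n := 2 * p - 1) ?_ ?_).trans_lt (by omega)
      · refine (natDegree_mul_le_of_le (natDegree_mul_le_of_le (natDegree_lagNumPoly y i).le
          (natDegree_C _).le) hA'd.le).trans (by omega)
      · refine (natDegree_mul_le_of_le (natDegree_mul_le_of_le (natDegree_lagNumPoly y i).le
          (hLd i).le) (natDegree_C _).le).trans (by omega)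
  have hzero : A * A' - γ - ∑ i, t i = 0 := by
    refine eq_zero_of_degree_lt_of_eval_index_eq_zero (ι := Fin p ⊕ Fin p)
      (v := Sum.elim (fun j => -y j) fun j => 1 - y j) Finset.univ ?_ ?_ ?_
    · rw [Finset.coe_univ, Set.injOn_univ]
      rintro (i | i) (j | j) h <;> simp only [Sum.elim_inl, Sum.elim_inr] at h
      · by_contra hij
        exact hy0 i j (fun h => hij (h ▸ rfl)) (by linear_combination -h)
      · rcases eq_or_ne i j with rfl | hij
        · exact absurd (by linear_combination -h) (one_ne_zero (α := F))
        · exact (hy1 j i hij.symm (by linear_combination h)).elim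
      · rcases eq_or_ne i j with rfl | hij
        · exact absurd (by linear_combination h) (one_ne_zero (α := F))
        · exact (hy1 i j hij (by linear_combination -h)).elim
      · by_contra hij
        exact hy0 i j (fun h => hij (h ▸ rfl)) (by linear_combination -h)
    · rw [mem_degreeLT] at hdeg
      simpa [two_mul] using hdeg
    · rintro (j | j) - <;> rw [heval] <;> simp only [Sum.elim_inl, Sum.elim_inr]
      · have hne : lagNum y j (-y j) ≠ 0 := lagNum_ne_zero fun m hm h =>
          hy0 m j hm (by linear_combination h)
        have hne' : lagNum y j (-y j - 1) ≠ 0 := lagNum_ne_zero fun m hm h =>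
          hy1 m j hm (by linear_combination h)
        rw [Finset.sum_eq_single j]
        · rw [rootProd_eq_zero, rootProd_eq y j (-y j - 1), ladderCommLead_self, diagCoeff,
            lag_eq, lag_eq, lagNum_add_single, hg (y j + 1)]
          have e1 : lagLead y j = (lagNum y j (-y j))⁻¹ := rfl
          have e2 : lagLead (y + Pi.single j 1) j = (lagNum y j (-y j - 1))⁻¹ := by
            simp [lagLead, lagNum_add_single, sub_eq_add_neg, add_comm]
          rw [e1, e2, show (1 - (y j + 1)) = -y j by ring]
          field_simp
          ring
        · intro i _ hij
          rw [ladderCommLead_self, lag_eq, lagNum_add_single, lagNum_eq_zero hij.symm]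
          ring
        · simp
      · have hne : lagNum y j (-y j) ≠ 0 := lagNum_ne_zero fun m hm h =>
          hy0 m j hm (by linear_combination h)
        have hne' : lagNum y j (1 - y j) ≠ 0 := lagNum_ne_zero fun m hm h =>
          hy1 j m hm.symm (by linear_combination -h)
        have e : 1 - y j - 1 = -y j := by ring
        rw [Finset.sum_eq_single j, e, rootProd_eq_zero]
        · rw [lag_eq, lag_eq, lagNum_add_single, hg (y j)]
          have e1 : lagLead y j = (lagNum y j (-y j))⁻¹ := rfl
          have e2 : lagLead (y + Pi.single j (-1)) j = (lagNum y j (1 - y j))⁻¹ := by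
            simp [lagLead, lagNum_add_single, sub_eq_add_neg]
          rw [e1, e2]
          field_simp
          ring
        · intro i _ hij
          rw [e, rootProd_eq_zero, lag_eq y, lagNum_eq_zero hij.symm]
          ring
        · simp
  have := heval u
  rw [hzero, eval_zero] at this
  linear_combination -this

end Diagonal

section Operators

variable {F : Type*} [Field F] {p : ℕ}

theorem map_seqEval {M N : Type*} [AddCommGroup M] [Module F M] [AddCommGroup N] [Module F N]
    (T : M →ₗ[F] N) (p : ℕ) (x : ℕ → M) (u : F) :
    T (seqEval p x u) = seqEval p (fun r => T (x r)) u := by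
  simp [seqEval]

theorem seqEval_apply {ι M : Type*} [AddCommGroup M] [Module F M] (p : ℕ) (x : ℕ → ι → M)
    (u : F) (k : ι) : seqEval p x u k = seqEval p (fun r => x r k) u := by
  simp [seqEval]

/-- The sequence of coefficients of `q`, read from degree `p` downwards. -/
noncomputable def polySeq (p : ℕ) (q : F[X]) (r : ℕ) : F := if r ≤ p then q.coeff (p - r) else 0

theorem polySeq_eq_zero (q : F[X]) {r : ℕ} (h : p < r) : polySeq p q r = 0 := if_neg (by omega)

theorem seqEval_polySeq {q : F[X]} (h : q.natDegree ≤ p) (u : F) :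
    seqEval p (polySeq p q) u = q.eval u := by
  rw [seqEval, eval_eq_sum_range' (Nat.lt_succ_of_le h), ← Finset.sum_range_reflect]
  refine Finset.sum_congr rfl fun r hr => ?_
  rw [Finset.mem_range] at hr
  rw [polySeq, if_pos (by omega), smul_eq_mul, mul_comm, show p + 1 - 1 - r = p - r by omega,
    show p - (p - r) = r by omega]

/-- The point `x + k` of the lattice `x + ℤ^p`. -/
def latticePoint (x : Fin p → F) (k : Fin p → ℤ) : Fin p → F := fun m => x m + k m

theorem latticePoint_add_single (x : Fin p → F) (k : Fin p → ℤ) (i : Fin p) (s : ℤ) :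
    latticePoint x (k + Pi.single i s) = latticePoint x k + Pi.single i (s : F) := by
  funext m
  rcases eq_or_ne m i with rfl | h
  · simp [latticePoint, add_assoc]
  · simp [latticePoint, h]

/-- Functions on the lattice `ℤ^p`. -/
abbrev LatticeFun (p : ℕ) (F : Type*) := (Fin p → ℤ) → F

/-- The operator sending the indicator function of `k` to the combination of the
indicator functions of `k - s e_i` with coefficients `φ i k`. -/
def ladder (s : ℤ) : (Fin p → LatticeFun p F) →ₗ[F] Module.End F (LatticeFun p F) :=
  LinearMap.mk₂ F (fun φ f k => ∑ i, φ i (k + Pi.single i s) * f (k + Pi.single i s))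
    (fun φ φ' f => by funext k; simp [add_mul, Finset.sum_add_distrib])
    (fun t φ f => by funext k; simp [Finset.mul_sum, mul_assoc])
    (fun φ f f' => by funext k; simp [mul_add, Finset.sum_add_distrib])
    (fun t φ f => by funext k; simp [Finset.mul_sum, mul_left_comm])

theorem ladder_apply (s : ℤ) (φ : Fin p → LatticeFun p F) (f : LatticeFun p F) (k : Fin p → ℤ) :
    ladder s φ f k = ∑ i, φ i (k + Pi.single i s) * f (k + Pi.single i s) := rfl

variable (x : Fin p → F)

/-- The coefficients of the diagonal operator with eigenvalues `rootPoly`. -/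
noncomputable def diagSeq (r : ℕ) : Module.End F (LatticeFun p F) :=
  Algebra.lmul F (LatticeFun p F) fun k => polySeq p (rootPoly (latticePoint x k)) r

/-- The coefficients of the weighted Lagrange polynomials at the lattice points. -/
noncomputable def lagSeq (w : F → F) (r : ℕ) (i : Fin p) : LatticeFun p F := fun k =>
  w (latticePoint x k i) *
    (lagLead (latticePoint x k) i * polySeq p (lagNumPoly (latticePoint x k) i) r)

/-- The coefficients of the ladder operator of step `-s` with weight `w`. -/
noncomputable def ladderSeq (s : ℤ) (w : F → F) (r : ℕ) : Module.End F (LatticeFun p F) :=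
  ladder s (lagSeq x w r)

theorem diagSeq_zero : diagSeq x 0 = 1 := by
  have h : ∀ k, polySeq p (rootPoly (latticePoint x k)) 0 = 1 := fun k => by
    rw [polySeq, if_pos (Nat.zero_le p), Nat.sub_zero]
    have := (rootPoly_monic (latticePoint x k)).coeff_natDegree
    rwa [natDegree_rootPoly] at this
  simp only [diagSeq, h]
  exact map_one (Algebra.lmul F (LatticeFun p F))

theorem diagSeq_eq_zero {r : ℕ} (hr : p < r) : diagSeq x r = 0 := by
  simp only [diagSeq, polySeq_eq_zero _ hr]
  exact map_zero (Algebra.lmul F (LatticeFun p F))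

theorem ladderSeq_eq_zero (s : ℤ) (w : F → F) {r : ℕ} (hr : p < r) : ladderSeq x s w r = 0 := by
  have : lagSeq x w r = 0 := by
    funext i k
    simp [lagSeq, polySeq_eq_zero _ hr]
  rw [ladderSeq, this, map_zero]

theorem ladderSeq_zero (s : ℤ) (w : F → F) : ladderSeq x s w 0 = 0 := by
  ext1 f
  funext k
  simp only [ladderSeq, ladder_apply, lagSeq, LinearMap.zero_apply, Pi.zero_apply]
  refine Finset.sum_eq_zero fun i _ => ?_
  have := i.2
  rw [polySeq, if_pos (Nat.zero_le p), coeff_eq_zero_of_natDegree_lt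
    (by rw [natDegree_lagNumPoly]; omega)]
  simp

theorem ladderSeq_one_apply (s : ℤ) (w : F → F) (f : LatticeFun p F) (k : Fin p → ℤ) :
    ladderSeq x s w 1 f k = ∑ i, w (latticePoint x (k + Pi.single i s) i) *
      lagLead (latticePoint x (k + Pi.single i s)) i * f (k + Pi.single i s) := by
  simp only [ladderSeq, ladder_apply, lagSeq]
  refine Finset.sum_congr rfl fun i _ => ?_
  have := i.2
  have h : ∀ y : Fin p → F, polySeq p (lagNumPoly y i) 1 = 1 := fun y => by
    rw [polySeq, if_pos (by omega)]
    have := (lagNumPoly_monic y i).coeff_natDegree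
    rwa [natDegree_lagNumPoly] at this
  rw [h, mul_one]

theorem seqEval_diagSeq_apply (u : F) (f : LatticeFun p F) (k : Fin p → ℤ) :
    seqEval p (diagSeq x) u f k = rootProd (latticePoint x k) u * f k := by
  have h2 : seqEval p (diagSeq x) u = Algebra.lmul F (LatticeFun p F)
      (seqEval p (fun r k => polySeq p (rootPoly (latticePoint x k)) r) u) :=
    (map_seqEval (Algebra.lmul F (LatticeFun p F)).toLinearMap p _ u).symm
  have h3 : seqEval p (diagSeq x) u f k =
      seqEval p (fun r k => polySeq p (rootPoly (latticePoint x k)) r) u k * f k := by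
    rw [h2]; rfl
  rw [h3, seqEval_apply, seqEval_polySeq (natDegree_rootPoly _).le, eval_rootPoly]

theorem seqEval_ladderSeq_apply (s : ℤ) (w : F → F) (u : F) (f : LatticeFun p F)
    (k : Fin p → ℤ) :
    seqEval p (ladderSeq x s w) u f k = ∑ i, w (latticePoint x (k + Pi.single i s) i) *
      lag (latticePoint x (k + Pi.single i s)) i u * f (k + Pi.single i s) := by
  have h2 : seqEval p (ladderSeq x s w) u = ladder s (seqEval p (lagSeq x w) u) := by
    simp only [seqEval, map_sum, map_smul, ladderSeq]
  rw [h2, ladder_apply]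
  refine Finset.sum_congr rfl fun i _ => ?_
  rw [seqEval_apply, seqEval_apply]
  simp only [lagSeq]
  rw [seqEval_mul_left, seqEval_mul_left, seqEval_polySeq, eval_lagNumPoly, lag_eq]
  · ring
  · rw [natDegree_lagNumPoly]; omega

end Operators

theorem sum_sum_eq_zero_of_antisymm {ι A : Type*} [Fintype ι] [AddCommGroup A] {f : ι → ι → A}
    (h0 : ∀ i, f i i = 0) (h : ∀ i j, i ≠ j → f i j + f j i = 0) : ∑ i, ∑ j, f i j = 0 := by
  classical
  rw [← Fintype.sum_prod_type']
  refine Finset.sum_involution (fun z _ => z.swap) (fun z _ => ?_) (fun z _ hz hz' => ?_)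
    (fun _ _ => Finset.mem_univ _) fun _ _ => rfl
  · rcases eq_or_ne z.1 z.2 with e | e
    · simp [e, h0]
    · exact h _ _ e
  · refine hz ?_
    have e : z.2 = z.1 := congrArg Prod.fst hz'
    rw [e, h0]

section Relations

variable {F : Type*} [Field F] {p : ℕ} (x : Fin p → F)

theorem diagSeq_comm (r s : ℕ) : diagSeq x r * diagSeq x s = diagSeq x s * diagSeq x r := by
  rw [diagSeq, diagSeq, ← map_mul, mul_comm, map_mul]

theorem ladder_diag_comm (s : ℤ) (w : F → F) (u v : F) :
    (u - v) • (seqEval p (diagSeq x) u * seqEval p (ladderSeq x s w) v -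
      seqEval p (ladderSeq x s w) v * seqEval p (diagSeq x) u) =
    (-s : F) • (seqEval p (diagSeq x) u * seqEval p (ladderSeq x s w) v -
      seqEval p (diagSeq x) v * seqEval p (ladderSeq x s w) u) := by
  ext1 f
  funext k
  simp only [LinearMap.smul_apply, LinearMap.sub_apply, Module.End.mul_apply, Pi.smul_apply,
    Pi.sub_apply, seqEval_diagSeq_apply, seqEval_ladderSeq_apply, smul_eq_mul, Finset.mul_sum,
    ← Finset.sum_sub_distrib]
  refine Finset.sum_congr rfl fun i _ => ?_
  rw [latticePoint_add_single, lag_add_single, lag_add_single, rootProd_add_single,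
    rootProd_eq _ i, rootProd_eq _ i]
  ring

theorem ladder_diag_comm' (s : ℤ) (w : F → F) (u v : F) :
    seqEval p (ladderSeq x s w) u * seqEval p (diagSeq x) v -
      seqEval p (ladderSeq x s w) v * seqEval p (diagSeq x) u =
    -(seqEval p (diagSeq x) u * seqEval p (ladderSeq x s w) v -
      seqEval p (diagSeq x) v * seqEval p (ladderSeq x s w) u) := by
  ext1 f
  funext k
  simp only [LinearMap.neg_apply, LinearMap.sub_apply, Module.End.mul_apply, Pi.neg_apply,
    Pi.sub_apply, seqEval_diagSeq_apply, seqEval_ladderSeq_apply, Finset.mul_sum,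
    ← Finset.sum_sub_distrib, ← Finset.sum_neg_distrib]
  refine Finset.sum_congr rfl fun i _ => ?_
  rw [latticePoint_add_single, lag_add_single, lag_add_single, rootProd_add_single,
    rootProd_add_single, rootProd_eq _ i, rootProd_eq _ i]
  ring

variable {x}

theorem latticePoint_sub_ne (hx : ∀ i j, i ≠ j → ∀ m : ℤ, x i - x j ≠ (m : F))
    (k : Fin p → ℤ) (i j : Fin p) (hij : i ≠ j) (m : ℤ) :
    latticePoint x k i - latticePoint x k j ≠ m := by
  intro h
  refine hx i j hij (m - k i + k j) ?_
  push_cast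
  rw [← h]
  simp only [latticePoint]
  ring

theorem seqEval_ladderSeq_comm (hx : ∀ i j, i ≠ j → ∀ m : ℤ, x i - x j ≠ (m : F))
    (s : ℤ) (w : F → F) (u v : F) :
    seqEval p (ladderSeq x s w) u * seqEval p (ladderSeq x s w) v =
      seqEval p (ladderSeq x s w) v * seqEval p (ladderSeq x s w) u := by
  rw [← sub_eq_zero]
  ext1 f
  funext k
  simp only [LinearMap.sub_apply, Module.End.mul_apply, Pi.sub_apply, seqEval_ladderSeq_apply,
    Finset.mul_sum, ← Finset.sum_sub_distrib, LinearMap.zero_apply, Pi.zero_apply]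
  have hy := latticePoint_sub_ne hx k
  generalize hY : latticePoint x k = y at hy
  simp only [latticePoint_add_single, hY]
  refine sum_sum_eq_zero_of_antisymm (fun i => ?_) fun i j hij => ?_
  · simp only [lag_eq, lagNum_add_single]
    ring
  · have h := lag_antisymm y hij (s : F) u v (by simpa using hy i j hij 0)
      (fun e => hy i j hij (-s) (by push_cast; linear_combination e))
      (fun e => hy j i hij.symm (-s) (by push_cast; linear_combination e))
    rw [add_right_comm k (Pi.single j s)]
    simp only [Pi.add_apply, Pi.single_eq_same, Pi.single_eq_of_ne hij, add_zero,
      Pi.single_eq_of_ne hij.symm]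
    linear_combination w (y i + s) * w (y j + s) * f (k + Pi.single i s + Pi.single j s) * h

theorem seqEval_ladderSeq_commutator_apply (g : F → F) (u v : F) (f : LatticeFun p F)
    (k : Fin p → ℤ) :
    (seqEval p (ladderSeq x (-1) fun _ => 1) u * seqEval p (ladderSeq x 1 g) v -
      seqEval p (ladderSeq x 1 g) v * seqEval p (ladderSeq x (-1) fun _ => 1) u) f k =
    ∑ i, ∑ j, ladderComm (latticePoint x k) g i j u v *
      f (k + Pi.single i (-1) + Pi.single j 1) := by
  simp only [LinearMap.sub_apply, Module.End.mul_apply, Pi.sub_apply, seqEval_ladderSeq_apply,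
    Finset.mul_sum]
  refine (congrArg₂ (· - ·) rfl Finset.sum_comm).trans ?_
  simp only [← Finset.sum_sub_distrib]
  refine Finset.sum_congr rfl fun i _ => Finset.sum_congr rfl fun j _ => ?_
  rw [ladderComm]
  simp only [latticePoint_add_single, Int.cast_neg, Int.cast_one]
  rw [add_right_comm k (Pi.single j 1)]
  ring

theorem adHom_ladderSeq_apply (g : F → F) (v : F) (f : LatticeFun p F) (k : Fin p → ℤ) :
    adHom (ladderSeq x (-1) (fun _ => 1) 1) (seqEval p (ladderSeq x 1 g) v) f k =
    ∑ i, ∑ j, ladderCommLead (latticePoint x k) g i j v *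
      f (k + Pi.single i (-1) + Pi.single j 1) := by
  simp only [adHom_apply, LinearMap.sub_apply, Module.End.mul_apply, Pi.sub_apply,
    seqEval_ladderSeq_apply, ladderSeq_one_apply, Finset.mul_sum]
  refine (congrArg₂ (· - ·) rfl Finset.sum_comm).trans ?_
  simp only [← Finset.sum_sub_distrib]
  refine Finset.sum_congr rfl fun i _ => Finset.sum_congr rfl fun j _ => ?_
  rw [ladderCommLead]
  simp only [latticePoint_add_single, Int.cast_neg, Int.cast_one]
  rw [add_right_comm k (Pi.single j 1)]
  ring

/-- The sequence of the remaining entry of the monodromy matrix. -/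
noncomputable def lastSeq (x : Fin p → F) (g : F → F) (r : ℕ) : Module.End F (LatticeFun p F) :=
  diagSeq x r - adHom (ladderSeq x (-1) (fun _ => 1) 1) (ladderSeq x 1 g r)

theorem seqEval_lastSeq_apply (g : F → F) (u : F) (f : LatticeFun p F) (k : Fin p → ℤ) :
    seqEval p (lastSeq x g) u f k = rootProd (latticePoint x k) u * f k -
      ∑ i, ∑ j, ladderCommLead (latticePoint x k) g i j u *
        f (k + Pi.single i (-1) + Pi.single j 1) := by
  have : seqEval p (lastSeq x g) u = seqEval p (diagSeq x) u -
      adHom (ladderSeq x (-1) (fun _ => 1) 1) (seqEval p (ladderSeq x 1 g) u) := by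
    rw [adHom_apply, ← seqEval_mul_left, ← seqEval_mul_right, ← seqEval_sub, ← seqEval_sub]
    rfl
  rw [this, LinearMap.sub_apply, Pi.sub_apply, seqEval_diagSeq_apply, adHom_ladderSeq_apply]

theorem seqEval_ladderSeq_commutator (g : F → F) (u v : F) :
    (u - v) • (seqEval p (ladderSeq x (-1) fun _ => 1) u * seqEval p (ladderSeq x 1 g) v -
      seqEval p (ladderSeq x 1 g) v * seqEval p (ladderSeq x (-1) fun _ => 1) u) =
    seqEval p (lastSeq x g) u * seqEval p (diagSeq x) v -
      seqEval p (lastSeq x g) v * seqEval p (diagSeq x) u := by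
  ext1 f
  funext k
  rw [LinearMap.smul_apply, Pi.smul_apply, seqEval_ladderSeq_commutator_apply]
  simp only [smul_eq_mul, Finset.mul_sum, ← mul_assoc, ladderComm_eq]
  simp only [LinearMap.sub_apply, Module.End.mul_apply, Pi.sub_apply, seqEval_diagSeq_apply,
    seqEval_lastSeq_apply, ← mul_assoc,
    latticePoint_add_single, Int.cast_neg, Int.cast_one, sub_mul, Finset.sum_sub_distrib]
  simp only [mul_comm (ladderCommLead _ _ _ _ _)]
  ring

theorem seqEval_lastSeq_mul (hx : ∀ i j, i ≠ j → ∀ m : ℤ, x i - x j ≠ (m : F))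
    {γ : F[X]} (hγ : γ.Monic) (hd : γ.natDegree = 2 * p) {g : F → F}
    (hg : ∀ z, g z = -γ.eval (1 - z)) (u : F) :
    seqEval p (lastSeq x g) u * seqEval p (diagSeq x) (u - 1) =
      algebraMap F _ (γ.eval u) +
        seqEval p (ladderSeq x (-1) fun _ => 1) u * seqEval p (ladderSeq x 1 g) (u - 1) := by
  ext1 f
  funext k
  simp only [LinearMap.add_apply, Module.End.mul_apply, Pi.add_apply, seqEval_diagSeq_apply,
    seqEval_lastSeq_apply, seqEval_ladderSeq_apply, Module.algebraMap_end_apply, Pi.smul_apply,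
    smul_eq_mul, Finset.mul_sum, one_mul, ← mul_assoc]
  rw [rootProd_mul_rootProd (latticePoint_sub_ne hx k) hγ hd hg u, add_mul, Finset.sum_mul,
    add_sub_assoc, ← Finset.sum_sub_distrib]
  refine congrArg₂ (· + ·) rfl (Finset.sum_congr rfl fun i _ => ?_)
  rw [← Finset.add_sum_erase _ _ (Finset.mem_univ i), ← Finset.add_sum_erase _ _ (Finset.mem_univ i),
    sub_add_eq_sub_sub, sub_eq_iff_eq_add]
  have hk : k + Pi.single i (-1) + Pi.single i 1 = k := by
    rw [add_assoc, ← Pi.single_add]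
    simp
  have h : ∀ j ∈ Finset.univ.erase i,
      lag (latticePoint x (k + Pi.single i (-1))) i u *
          g (latticePoint x (k + Pi.single i (-1) + Pi.single j 1) j) *
          lag (latticePoint x (k + Pi.single i (-1) + Pi.single j 1)) j (u - 1) *
          f (k + Pi.single i (-1) + Pi.single j 1) =
        -(ladderCommLead (latticePoint x k) g i j u *
          rootProd (latticePoint x (k + Pi.single i (-1) + Pi.single j 1)) (u - 1) *
          f (k + Pi.single i (-1) + Pi.single j 1)) := fun j hj => by
    have := lag_mul_lag_of_ne (latticePoint x k) g (Finset.ne_of_mem_erase hj).symm u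
    simp only [latticePoint_add_single, Int.cast_neg, Int.cast_one]
    linear_combination f (k + Pi.single i (-1) + Pi.single j 1) * this
  rw [Finset.sum_congr rfl h, Finset.sum_neg_distrib, hk]
  simp only [latticePoint_add_single, Int.cast_neg, Int.cast_one]
  ring

theorem evalScalar_map_algebraMap {R : Type*} [Ring R] [Algebra F R] (u : F) (q : F[X]) :
    evalScalar R u (q.map (algebraMap F R)) = algebraMap F R (q.eval u) := by
  have : (evalScalar R u).comp (mapRingHom (algebraMap F R)) =
      (algebraMap F R).comp (evalRingHom u) := by
    refine ringHom_ext (fun a => ?_) ?_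
    · simp [evalScalar_C]
    · simp [evalScalar_X]
  exact congrArg (fun f : F[X] →+* R => f q) this

theorem commute_of_seqEval [Infinite F] {R : Type*} [Ring R] [Algebra F R] {y z : ℕ → R}
    (hy : ∀ r, p < r → y r = 0) (hz : ∀ r, p < r → z r = 0)
    (h : ∀ u v : F, seqEval p y u * seqEval p z v = seqEval p z v * seqEval p y u) (r s : ℕ) :
    y r * z s = z s * y r := by
  by_cases hr : r ≤ p
  swap
  · simp [hy r (not_le.1 hr)]
  by_cases hs : s ≤ p
  swap
  · simp [hz s (not_le.1 hs)]
  rw [← sub_eq_zero]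
  refine seqEval_eq_zero (F := F) (x := fun s => y r * z s - z s * y r) (fun v => ?_) hs
  refine seqEval_eq_zero (F := F) (x := fun r => seqEval p (fun s => y r * z s - z s * y r) v)
    (fun u => ?_) hr
  simp only [seqEval_sub, seqEval_mul_left, seqEval_mul_right, h u v, sub_self]

theorem rtt_model [Infinite F] (hx : ∀ i j, i ≠ j → ∀ m : ℤ, x i - x j ≠ (m : F))
    {γ : F[X]} (hγ : γ.Monic) (hd : γ.natDegree = 2 * p) {g : F → F}
    (hg : ∀ z, g z = -γ.eval (1 - z)) {a b c d : ℕ → Module.End F (LatticeFun p F)}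
    (ha : a = diagSeq x) (hb : b = ladderSeq x (-1) fun _ => 1) (hc : c = ladderSeq x 1 g)
    (hd' : d = lastSeq x g) :
    (∀ i j k l, RTT (entries a b c d i j) (entries a b c d k l) (entries a b c d k j)
      (entries a b c d i l)) ∧ seqPoly p d * shiftHom _ (seqPoly p a) =
        γ.map (algebraMap F _) + seqPoly p b * shiftHom _ (seqPoly p c) := by
  have ha0 : a 0 = 1 := ha ▸ diagSeq_zero x
  have hb0 : b 0 = 0 := hb ▸ ladderSeq_zero x _ _
  have hc0 : c 0 = 0 := hc ▸ ladderSeq_zero x _ _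
  have hap : ∀ r, p < r → a r = 0 := fun r hr => ha ▸ diagSeq_eq_zero x hr
  have hbp : ∀ r, p < r → b r = 0 := fun r hr => hb ▸ ladderSeq_eq_zero x _ _ hr
  have hcp : ∀ r, p < r → c r = 0 := fun r hr => hc ▸ ladderSeq_eq_zero x _ _ hr
  have hda : ∀ s, adHom (b 1) (c s) = a s - d s := fun s => by
    rw [hd', hb, hc, ha, lastSeq, sub_sub_cancel]
  have hdp : ∀ r, p < r → d r = 0 := fun r hr => by
    have := hda r
    rw [hcp r hr, hap r hr, map_zero, zero_sub] at this
    exact neg_eq_zero.1 this.symm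
  have hab : ∀ u v : F, (u - v) • (seqEval p a u * seqEval p b v - seqEval p b v * seqEval p a u) =
      seqEval p a u * seqEval p b v - seqEval p a v * seqEval p b u := fun u v => by
    rw [ha, hb, ladder_diag_comm]
    simp
  have hab' : ∀ u v : F, seqEval p b u * seqEval p a v - seqEval p b v * seqEval p a u =
      -(seqEval p a u * seqEval p b v - seqEval p a v * seqEval p b u) := fun u v => by
    rw [ha, hb, ladder_diag_comm']
  have hac : ∀ u v : F, (u - v) • (seqEval p a u * seqEval p c v - seqEval p c v * seqEval p a u) =
      -(seqEval p a u * seqEval p c v - seqEval p a v * seqEval p c u) := fun u v => by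
    rw [ha, hc, ladder_diag_comm, Int.cast_one]
    module
  have hac' : ∀ u v : F, seqEval p c u * seqEval p a v - seqEval p c v * seqEval p a u =
      -(seqEval p a u * seqEval p c v - seqEval p a v * seqEval p c u) := fun u v => by
    rw [ha, hc, ladder_diag_comm']
  have hDu : ∀ u : F, seqEval p d u * seqEval p a (u - 1) = algebraMap F _ (γ.eval u) +
      seqEval p b u * seqEval p c (u - 1) := fun u => by
    rw [ha, hb, hc, hd', seqEval_lastSeq_mul hx hγ hd hg]
  have hD : seqPoly p d * shiftHom _ (seqPoly p a) =
      γ.map (algebraMap F _) + seqPoly p b * shiftHom _ (seqPoly p c) := by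
    refine eq_of_forall_evalScalar_eq (F := F) fun u => ?_
    rw [map_mul, map_add, map_mul, evalScalar_shiftHom, evalScalar_shiftHom]
    simp only [evalScalar_seqPoly]
    rw [hDu, evalScalar_map_algebraMap]
  have hG : ∀ e, adHom (C e) (γ.map (algebraMap F (Module.End F (LatticeFun p F)))) = 0 :=
    fun e => by
      rw [adHom_apply, sub_eq_zero]
      ext1 n
      rw [coeff_C_mul, coeff_mul_C, coeff_map, Algebra.commutes]
  refine ⟨rtt_completion ha0 hb0 hc0 hda hap hbp hcp (fun r s => ?_) ?_ ?_ ?_ ?_ ?_ ?_ ?_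
    (hG _) (hG _) hD, hD⟩
  · rw [ha, diagSeq_comm]
  · exact commute_of_seqEval hbp hbp fun u v => by rw [hb, seqEval_ladderSeq_comm hx]
  · exact commute_of_seqEval hcp hcp fun u v => by rw [hc, seqEval_ladderSeq_comm hx]
  · exact .of_seqEval (F := F) (by simp [ha0]) (by simp [hb0]) hap hbp hap hbp hab
  · refine .of_seqEval (F := F) (by simp [hb0]) (by simp [ha0]) hbp hap hbp hap fun u v => ?_
    have h1 := hab v u
    rw [hab', ← neg_sub v u, neg_smul, ← smul_neg, neg_sub, h1, neg_sub]
  · refine .of_seqEval (F := F) (by simp [ha0]) (by simp [hc0]) hap hcp hcp hap fun u v => ?_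
    rw [hac, hac']
  · refine .of_seqEval (F := F) (by simp [hc0]) (by simp [ha0]) hcp hap hap hcp fun u v => ?_
    have h1 := hac v u
    rw [← neg_sub v u, neg_smul, ← smul_neg, neg_sub, h1, neg_sub]
  · refine .of_seqEval (F := F) (by simp [hb0]) (by simp [hc0]) hbp hcp hdp hap fun u v => ?_
    rw [hb, hc, hd', ha, seqEval_ladderSeq_commutator]

end Relations

section Representation

theorem exists_algHom_of_rtt (K : Type) [Field K] (p : ℕ) {A : Type*} [Ring A] [Algebra K A]
    {T : Fin 2 → Fin 2 → ℕ → A} (h0 : ∀ i j, T i j 0 = if i = j then 1 else 0)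
    (hp : ∀ i j r, p < r → T i j r = 0)
    (h : ∀ i j k l, RTT (T i j) (T k l) (T k j) (T i l)) :
    ∃ Φ : Yp K p →ₐ[K] A, ∀ i j r, Φ (tY K p i j r) = T i j r := by
  let f : FreeAlgebra K (YGen p) →ₐ[K] A :=
    FreeAlgebra.lift K fun z => T z.1 z.2.1 (z.2.2 + 1)
  have hf : ∀ i j r, f (tF K p i j r) = T i j r := fun i j r => by
    rw [tF]
    split_ifs with hr hij hr'
    · rw [map_one, hr, h0, if_pos hij]
    · rw [map_zero, hr, h0, if_neg hij]
    · simp [f, show r - 1 + 1 = r by omega]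
    · rw [map_zero, hp i j r (by omega)]
  have hrel : ∀ ⦃y z : FreeAlgebra K (YGen p)⦄, YRel K p y z → f y = f z := by
    rintro _ _ ⟨i, j, k, l, r, s, -, -, -, -⟩
    simp only [map_sub, map_mul, map_sum, hf]
    exact (h i j k l).commutator_eq (fun a => by rw [h0]; split_ifs <;> simp) r s
  refine ⟨RingQuot.liftAlgHom K ⟨f, hrel⟩, fun i j r => ?_⟩
  rw [tY, RingQuot.liftAlgHom_mkAlgHom_apply, hf]

theorem map_seqPoly {R S : Type*} [Ring R] [Ring S] (f : R →+* S) (p : ℕ) (x : ℕ → R) :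
    (seqPoly p x).map f = seqPoly p fun r => f (x r) := by
  simp [seqPoly, Polynomial.map_sum]

theorem map_shiftHom {R S : Type*} [Ring R] [Ring S] (f : R →+* S) (q : R[X]) :
    (shiftHom R q).map f = shiftHom S (q.map f) := by
  have : (mapRingHom f).comp (shiftHom R) = (shiftHom S).comp (mapRingHom f) := by
    refine ringHom_ext (fun a => ?_) ?_
    · simp
    · simp
  exact congrArg (fun e : R[X] →+* S[X] => e q) this

theorem map_qdet {R S : Type*} [Ring R] [Ring S] (f : R →+* S) (p : ℕ)
    (T : Fin 2 → Fin 2 → ℕ → R) :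
    (qdet p T).map f = qdet p fun i j r => f (T i j r) := by
  simp only [qdet, Polynomial.map_sub, Polynomial.map_mul, map_seqPoly, map_shiftHom]

theorem map_eval_TY {K : Type} [Field K] {p : ℕ} {F A : Type*} [Field F] [Algebra K F] [Ring A]
    [Algebra K A] [Algebra F A] [IsScalarTower K F A] (Φ : Yp K p →ₐ[K] A) (i j : Fin 2) (u : K) :
    Φ ((TY K p i j).eval (algebraMap K (Yp K p) u)) =
      seqEval p (fun r => Φ (tY K p i j r)) (algebraMap K F u) := by
  rw [TY_eq_seqPoly, seqPoly, eval_finsetSum, map_sum, seqEval]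
  refine Finset.sum_congr rfl fun r _ => ?_
  rw [eval_C_mul, eval_X_pow, map_mul, map_pow, AlgHom.commutes, ← map_pow, ← map_pow,
    algebraMap_smul, Algebra.smul_def, Algebra.commutes]

theorem exists_algHom_model (K : Type) [Field K] {F : Type*} [Field F] [Infinite F] [Algebra K F]
    {p : ℕ} {x : Fin p → F} (hx : ∀ i j, i ≠ j → ∀ m : ℤ, x i - x j ≠ (m : F))
    {γ : F[X]} (hγ : γ.Monic) (hd : γ.natDegree = 2 * p) :
    ∃ Φ : Yp K p →ₐ[K] Module.End F (LatticeFun p F),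
      (∀ r, Φ (tY K p 1 1 r) = diagSeq x r) ∧
      (∀ u : K, Φ ((TY K p 1 0).eval (algebraMap K (Yp K p) u)) =
        seqEval p (ladderSeq x (-1) fun _ => 1) (algebraMap K F u)) ∧
      (∀ u : K, Φ ((TY K p 0 1).eval (algebraMap K (Yp K p) u)) =
        seqEval p (ladderSeq x 1 fun z => -γ.eval (1 - z)) (algebraMap K F u)) ∧
      ∀ n, Φ ((DY K p).coeff n) = algebraMap F _ (γ.coeff n) := by
  obtain ⟨h, hD⟩ := rtt_model hx hγ hd (g := fun z => -γ.eval (1 - z)) (fun _ => rfl) rfl rfl rfl rfl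
  have hl0 : lastSeq x (fun z => -γ.eval (1 - z)) 0 = 1 := by
    rw [lastSeq, diagSeq_zero, ladderSeq_zero, map_zero, sub_zero]
  have hlp : ∀ r, p < r → lastSeq x (fun z => -γ.eval (1 - z)) r = 0 := fun r hr => by
    rw [lastSeq, diagSeq_eq_zero x hr, ladderSeq_eq_zero x _ _ hr, map_zero, sub_zero]
  obtain ⟨Φ, hΦ⟩ := exists_algHom_of_rtt K p (fun i j => by
      fin_cases i <;> fin_cases j <;> simp [entries, diagSeq_zero, ladderSeq_zero, hl0])
    (fun i j r hr => by
      fin_cases i <;> fin_cases j <;>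
        simp [entries, diagSeq_eq_zero x hr, ladderSeq_eq_zero x _ _ hr, hlp r hr]) h
  refine ⟨Φ, fun r => hΦ 1 1 r, fun u => ?_, fun u => ?_, fun n => ?_⟩
  · rw [map_eval_TY (F := F)]
    simp only [hΦ]
    rfl
  · rw [map_eval_TY (F := F)]
    simp only [hΦ]
    rfl
  · have h1 := map_qdet (Φ : Yp K p →+* Module.End F (LatticeFun p F)) p (tY K p)
    have h2 := congrArg (fun q => coeff q n) h1
    simp only [coeff_map, ← DY_eq_qdet] at h2
    refine h2.trans ?_
    rw [← coeff_map]
    congr 1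
    rw [← sub_eq_iff_eq_add] at hD
    rw [← hD, qdet]
    simp only [RingHom.coe_coe, hΦ]
    rfl

end Representation

section Reduction

variable {k L : Type*} [Field k] [Field L] [Algebra k[X] L]

/-- The element `f` of the fraction field of `k[X]` is regular at `0`, with value `c`. -/
def HasValueZero (f : L) (c : k) : Prop :=
  ∃ a b : k[X], b.eval 0 ≠ 0 ∧ f * algebraMap k[X] L b = algebraMap k[X] L a ∧
    c * b.eval 0 = a.eval 0

namespace HasValueZero

theorem of_polynomial (a : k[X]) : HasValueZero (algebraMap k[X] L a) (a.eval 0) :=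
  ⟨a, 1, by simp, by simp, by simp⟩

theorem const (c : k) : HasValueZero (algebraMap k[X] L (C c)) c := by
  simpa using HasValueZero.of_polynomial (L := L) (C c)

theorem zero : HasValueZero (0 : L) (0 : k) := ⟨0, 1, by simp, by simp, by simp⟩

theorem one : HasValueZero (1 : L) (1 : k) := ⟨1, 1, by simp, by simp, by simp⟩

variable {f f' : L} {c c' : k}

theorem add (h : HasValueZero f c) (h' : HasValueZero f' c') :
    HasValueZero (f + f') (c + c') := by
  obtain ⟨a, b, hb, e, e0⟩ := h
  obtain ⟨a', b', hb', e', e0'⟩ := h'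
  refine ⟨a * b' + a' * b, b * b', by simp [hb, hb'], ?_, ?_⟩
  · simp only [map_add, map_mul, ← e, ← e']
    ring
  · simp only [eval_add, eval_mul, ← e0, ← e0']
    ring

theorem mul (h : HasValueZero f c) (h' : HasValueZero f' c') :
    HasValueZero (f * f') (c * c') := by
  obtain ⟨a, b, hb, e, e0⟩ := h
  obtain ⟨a', b', hb', e', e0'⟩ := h'
  refine ⟨a * a', b * b', by simp [hb, hb'], ?_, ?_⟩
  · simp only [map_mul, ← e, ← e']
    ring
  · simp only [eval_mul, ← e0, ← e0']
    ring

theorem neg (h : HasValueZero f c) : HasValueZero (-f) (-c) := by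
  obtain ⟨a, b, hb, e, e0⟩ := h
  exact ⟨-a, b, hb, by rw [neg_mul, e, map_neg], by rw [neg_mul, e0, eval_neg]⟩

theorem sub (h : HasValueZero f c) (h' : HasValueZero f' c') :
    HasValueZero (f - f') (c - c') := by
  simpa only [sub_eq_add_neg] using h.add h'.neg

theorem sum {ι : Type*} (s : Finset ι) {f : ι → L} {c : ι → k}
    (h : ∀ i ∈ s, HasValueZero (f i) (c i)) : HasValueZero (∑ i ∈ s, f i) (∑ i ∈ s, c i) := by
  classical
  induction s using Finset.induction_on with
  | empty => simpa using zero
  | insert i s hi ih =>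
    rw [Finset.sum_insert hi, Finset.sum_insert hi]
    exact (h i (Finset.mem_insert_self i s)).add
      (ih fun j hj => h j (Finset.mem_insert_of_mem hj))

theorem prod {ι : Type*} (s : Finset ι) {f : ι → L} {c : ι → k}
    (h : ∀ i ∈ s, HasValueZero (f i) (c i)) : HasValueZero (∏ i ∈ s, f i) (∏ i ∈ s, c i) := by
  classical
  induction s using Finset.induction_on with
  | empty => simpa using one
  | insert i s hi ih =>
    rw [Finset.prod_insert hi, Finset.prod_insert hi]
    exact (h i (Finset.mem_insert_self i s)).mul
      (ih fun j hj => h j (Finset.mem_insert_of_mem hj))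

theorem pow (h : HasValueZero f c) (n : ℕ) : HasValueZero (f ^ n) (c ^ n) := by
  simpa using prod (Finset.range n) fun _ _ => h

theorem intCast (m : ℤ) : HasValueZero (m : L) (m : k) := by
  simpa using HasValueZero.of_polynomial (L := L) (m : k[X])

theorem polynomial_eval (q : k[X]) (h : HasValueZero f c) :
    HasValueZero ((q.map ((algebraMap k[X] L).comp C)).eval f) (q.eval c) := by
  rw [eval_map, eval₂_eq_sum, eval_eq_sum]
  exact sum _ fun i _ => (HasValueZero.const _).mul (h.pow i)

variable [IsFractionRing k[X] L]

theorem eq_zero (h : HasValueZero (0 : L) c) : c = 0 := by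
  obtain ⟨a, b, hb, e, e0⟩ := h
  rw [zero_mul, eq_comm, IsFractionRing.to_map_eq_zero_iff] at e
  rw [e, eval_zero] at e0
  exact (mul_eq_zero.1 e0).resolve_right hb

theorem inv (h : HasValueZero f c) (hc : c ≠ 0) : HasValueZero f⁻¹ c⁻¹ := by
  have hf : f ≠ 0 := fun hf => hc (eq_zero (L := L) (hf ▸ h))
  obtain ⟨a, b, hb, e, e0⟩ := h
  refine ⟨b, a, ?_, ?_, ?_⟩
  · rw [← e0]
    exact mul_ne_zero hc hb
  · rw [← e, inv_mul_cancel_left₀ hf]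
  · rw [← e0, inv_mul_cancel_left₀ hc]

theorem eq_zero_of_sum_smul_eq_zero {ι : Type*} {s : Finset ι} {q : ι → k[X]} {v : ι → ι → L}
    [DecidableEq ι] {a : ι → k} (ha : ∀ i ∈ s, a i ≠ 0)
    (hv : ∀ i ∈ s, ∀ j, HasValueZero (v i j) ((Pi.single i (a i) : ι → k) j))
    (h : ∑ i ∈ s, algebraMap k[X] L (q i) • v i = 0) : ∀ i ∈ s, q i = 0 := by
  have hX : ∀ n, ∀ i ∈ s, X ^ n ∣ q i := by
    intro n
    induction n with
    | zero => simp
    | succ n ih =>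
      choose! r hr using ih
      have h1 : algebraMap k[X] L (X ^ n) •
          ∑ i ∈ s, algebraMap k[X] L (r i) • v i = 0 := by
        rw [← h, Finset.smul_sum]
        refine Finset.sum_congr rfl fun i hi => ?_
        rw [smul_smul, ← map_mul, ← hr i hi]
      rw [smul_eq_zero_iff_right (by
        rw [Ne, IsFractionRing.to_map_eq_zero_iff]; exact pow_ne_zero _ X_ne_zero)] at h1
      intro i hi
      have h2 : HasValueZero ((∑ i ∈ s, algebraMap k[X] L (r i) • v i) i)
          (∑ j ∈ s, (r j).eval 0 * (Pi.single j (a j) : ι → k) i) := by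
        simp only [Finset.sum_apply, Pi.smul_apply, smul_eq_mul]
        exact sum s fun j hj => (HasValueZero.of_polynomial _).mul (hv j hj i)
      rw [h1, Pi.zero_apply] at h2
      have h3 := eq_zero h2
      rw [Finset.sum_eq_single_of_mem i hi fun j _ hj => by simp [Pi.single_eq_of_ne hj.symm],
        Pi.single_eq_same, mul_eq_zero, or_iff_left (ha i hi), ← coeff_zero_eq_eval_zero,
        ← X_dvd_iff] at h3
      rw [hr i hi, pow_succ]
      exact mul_dvd_mul_left _ h3
  intro i hi
  by_contra h0
  have := natDegree_le_of_dvd (hX ((q i).natDegree + 1) i hi) h0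
  rw [natDegree_X_pow] at this
  omega

end HasValueZero

end Reduction

section LadderAction

variable {F : Type*} [Field F] {p : ℕ}

/-- At a negated coordinate, a ladder operator moves an indicator function in one direction. -/
theorem seqEval_ladderSeq_single {x : Fin p → F} {s : ℤ} {w : F → F} {m : Fin p → ℤ} {i : Fin p}
    (h : lagNum (latticePoint x m) i (-latticePoint x m i) ≠ 0) (a : F) :
    seqEval p (ladderSeq x s w) (-latticePoint x m i) (Pi.single m a) =
      Pi.single (m - Pi.single i s) (w (latticePoint x m i) * a) := by
  funext n
  rw [seqEval_ladderSeq_apply]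
  have h1 : ∀ j, w (latticePoint x (n + Pi.single j s) j) *
      lag (latticePoint x (n + Pi.single j s)) j (-latticePoint x m i) *
        (Pi.single m a : LatticeFun p F) (n + Pi.single j s) =
      if j = i then (Pi.single (m - Pi.single i s) (w (latticePoint x m i) * a) :
        LatticeFun p F) n else 0 := fun j => by
    by_cases hj : n + Pi.single j s = m
    · rw [hj, Pi.single_eq_same]
      split_ifs with hij
      · subst hij
        rw [← hj, add_sub_cancel_right, Pi.single_eq_same, hj, lag, mul_inv_cancel₀ h, mul_one]
      · rw [lag, lagNum_eq_zero (Ne.symm hij), zero_mul, mul_zero, zero_mul]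
    · rw [Pi.single_eq_of_ne hj, mul_zero]
      split_ifs with hij
      · subst hij
        rw [Pi.single_eq_of_ne]
        rintro rfl
        exact hj (sub_add_cancel _ _)
      · rfl
  simp only [h1, Finset.sum_ite_eq', Finset.mem_univ, if_true]

end LadderAction

section LadderReduction

variable {k L : Type*} [Field k] [Field L] [Algebra k[X] L] {p : ℕ}

theorem HasValueZero.latticePoint {x : Fin p → L} {y : Fin p → k}
    (hxy : ∀ i, HasValueZero (x i) (y i)) (n : Fin p → ℤ) (i : Fin p) :
    HasValueZero (latticePoint x n i) (_root_.latticePoint y n i) :=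
  (hxy i).add (.intCast _)

variable [IsFractionRing k[X] L]

theorem HasValueZero.lag {x : Fin p → L} {y : Fin p → k}
    (hxy : ∀ i, HasValueZero (x i) (y i)) {i : Fin p} (h : lagNum y i (-y i) ≠ 0)
    {u : L} {u' : k} (hu : HasValueZero u u') :
    HasValueZero (lag x i u) (_root_.lag y i u') :=
  (HasValueZero.prod _ fun j _ => hu.add (hxy j)).mul
    ((HasValueZero.prod _ fun j _ => (hxy i).neg.add (hxy j)).inv h)

theorem HasValueZero.seqEval_ladderSeq {x : Fin p → L} {y : Fin p → k}
    (hxy : ∀ i, HasValueZero (x i) (y i))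
    (hy : ∀ n i, lagNum (_root_.latticePoint y n) i (-_root_.latticePoint y n i) ≠ 0)
    (s : ℤ) {w : L → L} {w' : k → k} (hw : ∀ z z', HasValueZero z z' → HasValueZero (w z) (w' z'))
    {u : L} {u' : k} (hu : HasValueZero u u') {v : LatticeFun p L} {v' : LatticeFun p k}
    (hv : ∀ n, HasValueZero (v n) (v' n)) (n : Fin p → ℤ) :
    HasValueZero (seqEval p (ladderSeq x s w) u v n) (seqEval p (ladderSeq y s w') u' v' n) := by
  rw [seqEval_ladderSeq_apply, seqEval_ladderSeq_apply]
  exact .sum _ fun i _ => ((hw _ _ (.latticePoint hxy _ _)).mul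
    (.lag (.latticePoint hxy _) (hy _ _) hu)).mul (hv _)

/-- At `0`, the function `v` specializes to a nonzero multiple of the indicator function
of `m`. -/
def SpecializesTo (k : Type*) [Field k] [Algebra k[X] L] (v : LatticeFun p L)
    (m : Fin p → ℤ) : Prop :=
  ∃ a : k, a ≠ 0 ∧ ∀ n, HasValueZero (v n) ((Pi.single m a : LatticeFun p k) n)

theorem SpecializesTo.seqEval_ladderSeq {x : Fin p → L} {y : Fin p → k}
    (hxy : ∀ i, HasValueZero (x i) (y i))
    (hy : ∀ n i, lagNum (latticePoint y n) i (-latticePoint y n i) ≠ 0)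
    (s : ℤ) {w : L → L} {w' : k → k} (hw : ∀ z z', HasValueZero z z' → HasValueZero (w z) (w' z'))
    {v : LatticeFun p L} {m : Fin p → ℤ} (hv : SpecializesTo k v m) {i : Fin p}
    (hw0 : w' (latticePoint y m i) ≠ 0) {u : L} (hu : HasValueZero u (-latticePoint y m i)) :
    SpecializesTo k (seqEval p (ladderSeq x s w) u v) (m - Pi.single i s) := by
  obtain ⟨a, ha, hv⟩ := hv
  refine ⟨_, mul_ne_zero hw0 ha, fun n => ?_⟩
  rw [← seqEval_ladderSeq_single (hy m i)]
  exact HasValueZero.seqEval_ladderSeq hxy hy s hw hu hv n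

end LadderReduction

section Products

variable {A : Type*} [Monoid A] {p : ℕ}

/-- If the elements `y i n` shift the index of a family of predicates by `n t e_i` on the
hyperplane `m_i = 0`, then so do their products over lists of distinct indices. -/
theorem prod_map_shift {V : Type*} [MulAction A V] {P : V → (Fin p → ℤ) → Prop} (t : ℤ)
    (y : Fin p → ℕ → A) (hy0 : ∀ i, y i 0 = 1)
    (hy : ∀ i n v m, m i = 0 → P v m → P (y i n • v) (m + Pi.single i (n * t)))
    (κ : Fin p → ℕ) {l : List (Fin p)} (hl : l.Nodup) {v : V} {m : Fin p → ℤ}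
    (hm : ∀ i ∈ l, κ i ≠ 0 → m i = 0) (h : P v m) :
    P ((l.map fun i => y i (κ i)).prod • v) (fun j => m j + if j ∈ l then κ j * t else 0) := by
  induction l with
  | nil => simpa using h
  | cons i l ih =>
    rw [List.nodup_cons] at hl
    have h1 := ih hl.2 fun j hj => hm j (List.mem_cons_of_mem _ hj)
    rw [List.map_cons, List.prod_cons, mul_smul]
    by_cases hi : κ i = 0
    · rw [hi, hy0, one_smul]
      convert h1 using 2 with j
      by_cases hj : j = i
      · subst hj
        simp [hi]
      · simp [hj]
    · convert hy i (κ i) _ _ ?_ h1 using 1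
      · funext j
        by_cases hj : j = i
        · subst hj
          simp [hl.1]
        · simp [hj]
      · simp [hl.1, hm i List.mem_cons_self hi]

end Products

section Tau

variable {K : Type} [Field K] {k L : Type*} [Field k] [Algebra K k] [Field L] [Algebra k[X] L]
  [Algebra K L] [IsScalarTower K k[X] L]

theorem HasValueZero.base (t : K) : HasValueZero (algebraMap K L t) (algebraMap K k t) := by
  rw [IsScalarTower.algebraMap_apply K k[X] L, Polynomial.algebraMap_apply]
  exact .const _

variable [IsFractionRing k[X] L] {p : ℕ}

theorem specializesTo_tau {β : Fin p → K} {x : Fin p → L} {γ : k[X]}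
    (hβ : ∀ i j, i ≠ j → ∀ m : ℤ, β i - β j ≠ (m : K))
    (hx : ∀ i, HasValueZero (x i) (algebraMap K k (β i)))
    (hγ : Fin p → ∀ t : K, γ.eval (algebraMap K k t) ≠ 0)
    {Φ : Yp K p →ₐ[K] Module.End L (LatticeFun p L)}
    (h21 : ∀ u : K, Φ ((TY K p 1 0).eval (algebraMap K (Yp K p) u)) =
        seqEval p (ladderSeq x (-1) fun _ => 1) (algebraMap K L u))
    (h12 : ∀ u : K, Φ ((TY K p 0 1).eval (algebraMap K (Yp K p) u)) =
        seqEval p (ladderSeq x 1 fun z => -(γ.map ((algebraMap k[X] L).comp C)).eval (1 - z))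
          (algebraMap K L u)) (κ : Fin p → ℤ) :
    SpecializesTo k (Φ (tau K p β κ) (Pi.single 0 1)) κ := by
  have hpt : ∀ m i, latticePoint (fun i => algebraMap K k (β i)) m i =
      algebraMap K k (β i + m i) := fun m i => by simp [latticePoint]
  have hy : ∀ n i, lagNum (latticePoint (fun i => algebraMap K k (β i)) n) i
      (-latticePoint (fun i => algebraMap K k (β i)) n i) ≠ 0 := fun n i => by
    refine lagNum_ne_zero fun j hj => ?_
    rw [hpt, hpt, ← map_neg, ← map_add, Ne, map_eq_zero, neg_add_eq_zero]
    intro e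
    refine hβ j i hj (n i - n j) ?_
    push_cast
    linear_combination -e
  have step21 : ∀ i (n : ℕ) (v : LatticeFun p L) (m : Fin p → ℤ), m i = 0 → SpecializesTo k v m →
      SpecializesTo k (Φ (prod21 K p β i n) • v) (m + Pi.single i ((n : ℤ) * 1)) := by
    intro i n v m hm hv
    induction n with
    | zero => simpa [prod21] using hv
    | succ n ih =>
      rw [prod21, map_mul, mul_smul, h21]
      have h1 := ih.seqEval_ladderSeq (u := algebraMap K L (-β i - n)) hx hy (-1)
        (w := fun _ => 1) (w' := fun _ => 1) (fun _ _ _ => .one) (i := i) one_ne_zero (by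
          rw [hpt, ← map_neg]
          convert HasValueZero.base (L := L) (k := k) (-β i - (n : K)) using 2
          simp [hm]
          ring)
      rw [add_sub_assoc, ← Pi.single_sub] at h1
      rwa [show ((n + 1 : ℕ) : ℤ) * 1 = n * 1 - (-1) by push_cast; ring]
  have step12 : ∀ i (n : ℕ) (v : LatticeFun p L) (m : Fin p → ℤ), m i = 0 → SpecializesTo k v m →
      SpecializesTo k (Φ (prod12 K p β i n) • v) (m + Pi.single i ((n : ℤ) * (-1))) := by
    intro i n v m hm hv
    induction n with
    | zero => simpa [prod12] using hv
    | succ n ih =>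
      rw [prod12, map_mul, mul_smul, h12]
      have h1 := ih.seqEval_ladderSeq (u := algebraMap K L (-β i + n)) hx hy 1
        (w' := fun z => -γ.eval (1 - z))
        (fun _ _ hz => (HasValueZero.polynomial_eval γ (HasValueZero.one.sub hz)).neg) (i := i) (by
          rw [hpt, ← map_one (algebraMap K k), ← map_sub]
          exact neg_ne_zero.2 (hγ i _)) (by
          rw [hpt, ← map_neg]
          convert HasValueZero.base (L := L) (k := k) (-β i + (n : K)) using 2
          simp [hm]
          ring)
      rw [add_sub_assoc, ← Pi.single_sub] at h1
      rwa [show ((n + 1 : ℕ) : ℤ) * (-1) = n * (-1) - 1 by push_cast; ring]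
  have h0 : SpecializesTo k (Pi.single 0 1 : LatticeFun p L) 0 := by
    refine ⟨1, one_ne_zero, fun n => ?_⟩
    by_cases hn : n = 0
    · subst hn
      simpa using HasValueZero.one
    · simpa [hn] using HasValueZero.zero
  have h1 := prod_map_shift (P := SpecializesTo k) (-1) (fun i n => Φ (prod12 K p β i n))
    (fun i => by simp [prod12]) step12 (fun i => (-κ i).toNat) (List.nodup_finRange p)
    (fun _ _ _ => rfl) h0
  have h2 := prod_map_shift (P := SpecializesTo k) 1 (fun i n => Φ (prod21 K p β i n))
    (fun i => by simp [prod21]) step21 (fun i => (κ i).toNat) (List.nodup_finRange p)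
    (fun i _ hi => by simp; omega) h1
  rw [tau, map_mul, map_list_prod, map_list_prod, List.map_map, List.map_map]
  have e : κ = fun j => (0 + if j ∈ List.finRange p then ((-κ j).toNat : ℤ) * -1 else 0) +
      if j ∈ List.finRange p then ((κ j).toNat : ℤ) * 1 else 0 := by
    funext j
    simp only [List.mem_finRange, if_true]
    omega
  rw [← e] at h2
  exact h2

end Tau

section Symmetric

/-- Replacing the first set of variables by their elementary symmetric polynomials. -/
noncomputable def esymmInl (R τ : Type*) [CommRing R] (p : ℕ) :
    MvPolynomial (Fin p ⊕ τ) R →ₐ[R] MvPolynomial (Fin p ⊕ τ) R :=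
  MvPolynomial.aeval (Sum.elim
    (fun i => MvPolynomial.rename Sum.inl (MvPolynomial.esymm (Fin p) R (i + 1)))
    fun j => MvPolynomial.X (Sum.inr j))

theorem esymmInl_injective (R τ : Type*) [CommRing R] (p : ℕ) :
    Function.Injective (esymmInl R τ p) := by
  let e := MvPolynomial.sumAlgEquiv R (Fin p) τ
  have he : ∀ P, e (esymmInl R τ p P) =
      (MvPolynomial.esymmAlgHom (Fin p) (MvPolynomial τ R) p (e P)).val := fun P => by
    rw [MvPolynomial.esymmAlgHom_apply]
    have h : e.toAlgHom.comp (esymmInl R τ p) =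
        ((MvPolynomial.aeval fun i : Fin p =>
          MvPolynomial.esymm (Fin p) (MvPolynomial τ R) (i + 1)).restrictScalars R).comp
          e.toAlgHom := by
      refine MvPolynomial.algHom_ext fun i => ?_
      rcases i with i | j
      · simp [esymmInl, e, MvPolynomial.esymm, MvPolynomial.rename_X]
      · simp [esymmInl, e]
    exact DFunLike.congr_fun h P
  intro P Q h
  have h1 := congrArg e h
  rw [he, he] at h1
  exact e.injective (MvPolynomial.esymmAlgHom_injective _ (by simp) (Subtype.ext h1))

end Symmetric

section GenericMonic

variable {k : Type*} [Field k]

/-- The monic polynomial of degree `n` with given lower coefficients, listed downwards. -/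
noncomputable def monicOfCoeffs {n : ℕ} (g : Fin n → k) : k[X] :=
  X ^ n + ∑ j, C (g j) * X ^ (n - (j + 1))

theorem degree_sum_coeffs_lt {n : ℕ} (g : Fin n → k) :
    (∑ j, C (g j) * X ^ (n - (j + 1)) : k[X]).degree < n := by
  refine (degree_sum_le _ _).trans_lt ((Finset.sup_lt_iff (WithBot.bot_lt_coe n)).2 fun j _ => ?_)
  exact (degree_C_mul_X_pow_le _ _).trans_lt (Nat.cast_lt.2 (by omega))

theorem monicOfCoeffs_monic {n : ℕ} (g : Fin n → k) : (monicOfCoeffs g).Monic :=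
  monic_X_pow_add (degree_sum_coeffs_lt g)

theorem natDegree_monicOfCoeffs {n : ℕ} (g : Fin n → k) : (monicOfCoeffs g).natDegree = n := by
  refine natDegree_eq_of_degree_eq_some ?_
  rw [monicOfCoeffs, degree_add_eq_left_of_degree_lt, degree_X_pow]
  rw [degree_X_pow]
  exact degree_sum_coeffs_lt g

theorem coeff_monicOfCoeffs {n : ℕ} (g : Fin n → k) (j : Fin n) :
    (monicOfCoeffs g).coeff (n - (j + 1)) = g j := by
  rw [monicOfCoeffs, coeff_add, coeff_X_pow, if_neg (by omega), zero_add, finsetSum_coeff,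
    Finset.sum_eq_single j]
  · simp
  · intro i _ hi
    rw [coeff_C_mul_X_pow, if_neg]
    have := Fin.val_ne_of_ne hi
    omega
  · simp

theorem eval_monicOfCoeffs_ne_zero {K : Type*} [Field K] [Algebra K k] {n : ℕ} (hn : 0 < n)
    {g : Fin n → k} (hg : AlgebraicIndependent K g) (t : K) :
    (monicOfCoeffs g).eval (algebraMap K k t) ≠ 0 := by
  intro h
  let P : MvPolynomial (Fin n) K := MvPolynomial.C (t ^ n) +
    ∑ j : Fin n, MvPolynomial.X j * MvPolynomial.C (t ^ (n - ((j : ℕ) + 1)))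
  have hP : MvPolynomial.aeval g P = 0 := by
    rw [← h]
    simp [P, monicOfCoeffs, eval_finsetSum]
  have h0 : P = 0 := hg.eq_zero_of_aeval_eq_zero _ hP
  have h1 := congrArg (MvPolynomial.eval (Pi.single (⟨n - 1, by omega⟩ : Fin n) (1 - t ^ n))) h0
  simp only [P, map_add, map_sum, map_mul, MvPolynomial.eval_C, MvPolynomial.eval_X, map_zero] at h1
  rw [Finset.sum_eq_single (⟨n - 1, by omega⟩ : Fin n)
    (fun j _ hj => by rw [Pi.single_eq_of_ne hj, zero_mul]) (by simp), Pi.single_eq_same] at h1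
  simp [show n - (n - 1 + 1) = 0 by omega] at h1

end GenericMonic

section HighestWeight

theorem diagSeq_single_zero {F : Type*} [Field F] {p : ℕ} (x : Fin p → F) (r : ℕ) :
    diagSeq x r (Pi.single 0 1) =
      polySeq p (rootPoly x) r • (Pi.single 0 1 : LatticeFun p F) := by
  funext n
  have h : latticePoint x 0 = x := by
    funext m
    simp [latticePoint]
  by_cases hn : n = 0
  · subst hn
    simp [diagSeq, h]
  · simp [diagSeq, hn]

theorem map_esymm {R S : Type*} [CommRing R] [Field S] (f : R →+* S) {p : ℕ} (x : Fin p → R)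
    (i : Fin p) : polySeq p (rootPoly fun m => f (x m)) (i + 1) =
      f (∑ t ∈ Finset.univ.powersetCard (i + 1), ∏ m ∈ t, x m) := by
  rw [polySeq, if_pos (by omega), rootPoly, Finset.prod_X_add_C_coeff _ _ (by simp)]
  simp [show p - (p - ((i : ℕ) + 1)) = i + 1 by omega]

theorem apply_eq_smul_of_X {σ K R F A V : Type*} [CommRing K] [CommRing R] [Algebra K R] [Field F]
    [Algebra R F] [Algebra K F] [IsScalarTower K R F] [Ring A] [Algebra K A] [AddCommGroup V]
    [Module F V] [Algebra K (Module.End F V)] [IsScalarTower K F (Module.End F V)]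
    (Ψ : MvPolynomial σ K →ₐ[K] Module.End F V)
    (χ : MvPolynomial σ K →ₐ[K] R) (v : V)
    (h : ∀ i, Ψ (MvPolynomial.X i) v = algebraMap R F (χ (MvPolynomial.X i)) • v)
    (P : MvPolynomial σ K) : Ψ P v = algebraMap R F (χ P) • v := by
  induction P using MvPolynomial.induction_on with
  | C a =>
    rw [← MvPolynomial.algebraMap_eq, AlgHom.commutes, AlgHom.commutes,
      ← IsScalarTower.algebraMap_apply, IsScalarTower.algebraMap_apply K F (Module.End F V)]
    rfl
  | add P Q hP hQ => rw [map_add, LinearMap.add_apply, hP, hQ, map_add, map_add, add_smul]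
  | mul_X P i hP =>
    rw [map_mul, Module.End.mul_apply, h, map_smul, hP, map_mul, map_mul, mul_comm, mul_smul]

end HighestWeight

section LineThroughBase

variable {K k : Type*} [Field K] [Field k] [Algebra K k] {p : ℕ}

/-- The line through `β` at `0` and `l` at `1`. -/
noncomputable def line (β : Fin p → K) (l : Fin p → k) (i : Fin p) : k[X] :=
  C (algebraMap K k (β i)) + X * C (l i - algebraMap K k (β i))

theorem eval_zero_line (β : Fin p → K) (l : Fin p → k) (i : Fin p) :
    (line β l i).eval 0 = algebraMap K k (β i) := by simp [line]

theorem eval_one_line (β : Fin p → K) (l : Fin p → k) (i : Fin p) :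
    (line β l i).eval 1 = l i := by simp [line]

theorem line_sub_line_ne {β : Fin p → K} (hβ : ∀ i j, i ≠ j → ∀ m : ℤ, β i - β j ≠ (m : K))
    (l : Fin p → k) {i j : Fin p} (hij : i ≠ j) (m : ℤ) : line β l i - line β l j ≠ (m : k[X]) := by
  intro h
  have h1 := congrArg (eval 0) h
  rw [eval_sub, eval_zero_line, eval_zero_line, eval_intCast, ← map_sub,
    ← map_intCast (algebraMap K k)] at h1
  exact hβ i j hij m ((algebraMap K k).injective h1)

/-- The character of `K[t, d]` sending the `t_i` to the elementary symmetric polynomials of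
a point of `k[X]^p` and the `d_j` to constants. -/
noncomputable def weightHom (y : Fin p → k[X]) {n : ℕ} (g : Fin n → k) :
    MvPolynomial (Fin p ⊕ Fin n) K →ₐ[K] k[X] :=
  MvPolynomial.aeval (Sum.elim
    (fun i => ∑ t ∈ Finset.univ.powersetCard (i + 1), ∏ m ∈ t, y m) fun j => C (g j))

theorem eval_one_weightHom (β : Fin p → K) (l : Fin p → k) {n : ℕ} (g : Fin n → k)
    (P : MvPolynomial (Fin p ⊕ Fin n) K) :
    (weightHom (line β l) g P).eval 1 =
      MvPolynomial.aeval (Sum.elim l g) (esymmInl K (Fin n) p P) := by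
  have h : ((aeval (1 : k)).restrictScalars K).comp (weightHom (line β l) g) =
      (MvPolynomial.aeval (Sum.elim l g)).comp (esymmInl K (Fin n) p) := by
    refine MvPolynomial.algHom_ext fun i => ?_
    rcases i with i | j
    · simp [weightHom, esymmInl, MvPolynomial.esymm, eval_one_line, eval_finsetSum,
        eval_prod]
    · simp [weightHom, esymmInl]
  simpa using DFunLike.congr_fun h P

theorem weightHom_line_injective (β : Fin p → K) {n : ℕ} {z : Fin p ⊕ Fin n → k}
    (hz : AlgebraicIndependent K z) :
    Function.Injective (weightHom (K := K) (line β fun i => z (.inl i)) fun j => z (.inr j)) := by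
  rw [injective_iff_map_eq_zero]
  intro P hP
  have h := eval_one_weightHom β (fun i => z (.inl i)) (fun j => z (.inr j)) P
  rw [hP, eval_zero, show Sum.elim (fun i => z (.inl i)) (fun j => z (.inr j)) = z from
    Sum.elim_comp_inl_inr z] at h
  exact (map_eq_zero_iff _ (esymmInl_injective K (Fin n) p)).1
    (hz.eq_zero_of_aeval_eq_zero _ h.symm)

end LineThroughBase

theorem exists_specializing_model {K : Type} [Field K] {p : ℕ} {β : Fin p → K}
    (hβ : ∀ i j, i ≠ j → ∀ m : ℤ, β i - β j ≠ (m : K)) {k L : Type*} [Field k] [Algebra K k]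
    [Field L] [Algebra k[X] L] [IsFractionRing k[X] L] [Algebra K L] [IsScalarTower K k[X] L]
    {z : Fin p ⊕ Fin (2 * p) → k} (hz : AlgebraicIndependent K z)
    {φ : MvPolynomial (Fin p ⊕ Fin (2 * p)) K →ₐ[K] Yp K p}
    (hφ : ∀ i, φ (MvPolynomial.X i) = gamGen K p i) :
    ∃ Φ : Yp K p →ₐ[K] Module.End L (LatticeFun p L),
      (∀ κ, SpecializesTo k (Φ (tau K p β κ) (Pi.single 0 1)) κ) ∧
      ∀ P, Φ (φ P) (Pi.single 0 1) = algebraMap k[X] L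
        (weightHom (line β fun i => z (.inl i)) (fun j => z (.inr j)) P) •
          (Pi.single 0 1 : LatticeFun p L) := by
  have hinj : Function.Injective (algebraMap k[X] L) := IsFractionRing.injective _ _
  have : Infinite L := .of_injective _ hinj
  set g : Fin (2 * p) → k := fun j => z (.inr j) with hg
  set x : Fin p → L := fun i => algebraMap k[X] L (line β (fun i => z (.inl i)) i) with hx
  have hxne : ∀ i j, i ≠ j → ∀ m : ℤ, x i - x j ≠ (m : L) := fun i j hij m h => by
    rw [← map_sub, ← map_intCast (algebraMap k[X] L)] at h
    exact line_sub_line_ne hβ _ hij m (hinj h)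
  obtain ⟨Φ, h22, h21, h12, hD⟩ := exists_algHom_model K hxne
    ((monicOfCoeffs_monic g).map ((algebraMap k[X] L).comp C))
    (by rw [(monicOfCoeffs_monic g).natDegree_map, natDegree_monicOfCoeffs])
  refine ⟨Φ, specializesTo_tau (x := x) hβ (fun i => ?_) (fun i t => ?_) h21 h12, ?_⟩
  · rw [← eval_zero_line β (fun i => z (.inl i)) i]
    exact .of_polynomial _
  · exact eval_monicOfCoeffs_ne_zero (by have := i.pos; omega)
      (hz.comp _ Sum.inr_injective) t
  · refine apply_eq_smul_of_X (A := Yp K p) (Φ.comp φ) _ _ fun i => ?_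
    rw [AlgHom.comp_apply, hφ, weightHom, MvPolynomial.aeval_X]
    rcases i with i | j
    · rw [gamGen, Sum.elim_inl, Sum.elim_inl, h22, diagSeq_single_zero, ← map_esymm]
    · rw [gamGen, Sum.elim_inr, Sum.elim_inr, dY, hD, coeff_map, coeff_monicOfCoeffs]
      rfl

/-- The elements `τ^(k)`, `k ∈ ℤ^p`, are linearly independent over `Γ` in the right
`Γ`-module `Y_p(gl_2)`: if `Σ_k τ^(k) c_k = 0` with `c_k ∈ Γ` almost all zero, then
all `c_k = 0`. -/
theorem tau_linearly_independent_over_Gamma (K : Type) [Field K] (p : ℕ)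
    (β : Fin p → K) (hβ : ∀ i j, i ≠ j → ∀ m : ℤ, β i - β j ≠ (m : K))
    (c : (Fin p → ℤ) →₀ Yp K p) (hc : ∀ k, c k ∈ Gam K p)
    (h : (c.sum fun k y => tau K p β k * y) = 0) : c = 0 := by
  let M := MvPolynomial (Fin p ⊕ Fin (2 * p)) K
  let k := FractionRing M
  let L := FractionRing k[X]
  obtain ⟨φ, hφ, hsurj⟩ := exists_algHom_mvPolynomial (K := K) (gamGen K p) (gamGen_commute K p)
  choose P hP using fun κ => hsurj (c κ) (Gam_le_adjoin_range K p (hc κ))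
  have hz : AlgebraicIndependent K fun i => algebraMap M k (MvPolynomial.X i) := by
    have := (MvPolynomial.algebraicIndependent_X (Fin p ⊕ Fin (2 * p)) K).map'
      (f := IsScalarTower.toAlgHom K M k) (IsFractionRing.injective M k)
    exact this
  obtain ⟨Φ, hτ, hw⟩ := exists_specializing_model (k := k) (L := L) hβ hz hφ
  choose a ha hv using hτ
  have hsum : ∑ κ ∈ c.support, algebraMap k[X] L
      (weightHom (line β fun i => algebraMap M k (MvPolynomial.X (.inl i)))
        (fun j => algebraMap M k (MvPolynomial.X (.inr j))) (P κ)) •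
        Φ (tau K p β κ) (Pi.single 0 1) = 0 := by
    have h1 := congrArg (fun y => Φ y (Pi.single 0 1)) h
    simp only [Finsupp.sum, map_sum, map_mul, LinearMap.sum_apply, Module.End.mul_apply, ← hP, hw,
      map_smul, map_zero, LinearMap.zero_apply] at h1
    exact h1
  have h0 := HasValueZero.eq_zero_of_sum_smul_eq_zero (fun κ _ => ha κ) (fun κ _ => hv κ) hsum
  ext κ
  by_contra hκ
  have h1 := h0 κ (Finsupp.mem_support_iff.2 hκ)
  rw [map_eq_zero_iff _ (weightHom_line_injective β hz)] at h1
  exact hκ (by rw [← hP, h1, map_zero, Finsupp.zero_apply])
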